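/- Let n ≥ 9 be an even integer and let E = (e_{ij}) be an n×n real array with e_{ij} = e_{ji} and e_{ii} = 0 for all i,j, such that ê_{ij} ≠ 0 for some i ≠ j (equivalently σ_E² > 0). Let π be chosen uniformly at random from Π_n and W = (Y_E − μ_E)/σ_E. Then for every p ∈ [1,∞], ||F_W − Φ||_p ≤ K_p · β_E / n, where K_p = 379^{1/p} · 61702446^{1−1/p} (with the conventions 1/∞ = 0 and ||·||_∞ the supremum norm). -/

import Mathlib

open Finset MeasureTheory ProbabilityTheory
open scoped ENNReal

noncomputable def stdNormalCDF (t : ℝ) : ℝ :=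
  (Real.sqrt (2 * Real.pi))⁻¹ * ∫ x in Set.Iic t, Real.exp (-(x ^ 2) / 2)

/-- The set of fixed-point-free involutions of `{1,…,n}`. -/
def fpfInvolutions (n : ℕ) : Finset (Equiv.Perm (Fin n)) :=
  Finset.univ.filter fun π => π * π = 1 ∧ ∀ i, π i ≠ i

open Filter Topology

/-! ### The standard normal distribution -/

/-- The standard normal density. -/
noncomputable def normalDensity (x : ℝ) : ℝ :=
  (Real.sqrt (2 * Real.pi))⁻¹ * Real.exp (-(x ^ 2) / 2)

lemma normalDensity_eq_gaussianPDFReal : normalDensity = gaussianPDFReal 0 1 := by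
  ext x
  simp [normalDensity, gaussianPDFReal]

lemma normalDensity_pos (x : ℝ) : 0 < normalDensity x := by
  unfold normalDensity; positivity

lemma normalDensity_neg (x : ℝ) : normalDensity (-x) = normalDensity x := by
  simp [normalDensity]

lemma normalDensity_le (x : ℝ) : normalDensity x ≤ 2 / 5 := by
  have h1 : (5 / 2 : ℝ) ≤ Real.sqrt (2 * Real.pi) := by
    apply Real.le_sqrt_of_sq_le
    nlinarith [Real.pi_gt_d2]
  have h2 : Real.exp (-(x ^ 2) / 2) ≤ 1 := Real.exp_le_one_iff.2 (by nlinarith [sq_nonneg x])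
  have h3 : (Real.sqrt (2 * Real.pi))⁻¹ ≤ 2 / 5 :=
    (inv_anti₀ (by norm_num) h1).trans (by norm_num)
  unfold normalDensity
  calc _ ≤ (Real.sqrt (2 * Real.pi))⁻¹ * 1 := by gcongr
    _ ≤ 2 / 5 := by linarith

lemma hasDerivAt_normalDensity (x : ℝ) :
    HasDerivAt normalDensity (-(x * normalDensity x)) x := by
  have h : HasDerivAt (fun y : ℝ => -(y ^ 2) / 2) (-x) x := by
    have := ((hasDerivAt_pow 2 x).neg).div_const 2
    refine this.congr_deriv ?_
    simp; ring
  have := (h.exp).const_mul (Real.sqrt (2 * Real.pi))⁻¹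
  refine this.congr_deriv ?_
  unfold normalDensity; ring

lemma continuous_normalDensity : Continuous normalDensity :=
  continuous_iff_continuousAt.2 fun x => (hasDerivAt_normalDensity x).continuousAt

lemma integrable_normalDensity : Integrable normalDensity := by
  rw [normalDensity_eq_gaussianPDFReal]; exact integrable_gaussianPDFReal 0 1

lemma stdNormalCDF_eq_integral (t : ℝ) :
    stdNormalCDF t = ∫ x in Set.Iic t, normalDensity x := by
  unfold stdNormalCDF normalDensity
  rw [integral_const_mul]

lemma stdNormalCDF_nonneg (t : ℝ) : 0 ≤ stdNormalCDF t := by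
  rw [stdNormalCDF_eq_integral]
  exact integral_nonneg fun x => (normalDensity_pos x).le

lemma stdNormalCDF_neg (t : ℝ) : stdNormalCDF (-t) = 1 - stdNormalCDF t := by
  have h1 : stdNormalCDF (-t) = ∫ x in Set.Ioi t, normalDensity x := by
    rw [stdNormalCDF_eq_integral, ← integral_comp_neg_Ioi]
    simp [normalDensity_neg]
  have h2 : ∫ x, normalDensity x = 1 := by
    rw [normalDensity_eq_gaussianPDFReal]; exact integral_gaussianPDFReal_eq_one 0 one_ne_zero
  have h3 := intervalIntegral.integral_Iic_add_Ioi
    (integrable_normalDensity.integrableOn (s := Set.Iic t)) integrable_normalDensity.integrableOn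
  rw [h1, stdNormalCDF_eq_integral]
  linarith

lemma stdNormalCDF_le_one (t : ℝ) : stdNormalCDF t ≤ 1 := by
  have := stdNormalCDF_nonneg (-t)
  rw [stdNormalCDF_neg] at this
  linarith

lemma hasDerivAt_stdNormalCDF (t : ℝ) : HasDerivAt stdNormalCDF (normalDensity t) t := by
  have h : stdNormalCDF = fun x => stdNormalCDF 0 + ∫ y in (0 : ℝ)..x, normalDensity y := by
    ext x
    rw [stdNormalCDF_eq_integral, stdNormalCDF_eq_integral,
      ← intervalIntegral.integral_Iic_sub_Iic integrable_normalDensity.integrableOn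
        integrable_normalDensity.integrableOn]
    ring
  rw [h]
  exact (intervalIntegral.integral_hasDerivAt_right
    (continuous_normalDensity.intervalIntegrable _ _)
    (continuous_normalDensity.stronglyMeasurableAtFilter _ _)
    continuous_normalDensity.continuousAt).const_add _

lemma continuous_stdNormalCDF : Continuous stdNormalCDF :=
  continuous_iff_continuousAt.2 fun x => (hasDerivAt_stdNormalCDF x).continuousAt

lemma monotone_stdNormalCDF : Monotone stdNormalCDF :=
  monotone_of_deriv_nonneg (fun x => (hasDerivAt_stdNormalCDF x).differentiableAt) fun x => by
    rw [(hasDerivAt_stdNormalCDF x).deriv]; exact (normalDensity_pos x).le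

lemma stdNormalCDF_sub_le {x y : ℝ} (h : x ≤ y) :
    stdNormalCDF y - stdNormalCDF x ≤ 2 / 5 * (y - x) := by
  refine Convex.image_sub_le_mul_sub_of_deriv_le convex_univ
    continuous_stdNormalCDF.continuousOn
    (fun x _ => (hasDerivAt_stdNormalCDF x).differentiableAt.differentiableWithinAt)
    (fun x _ => ?_) x (Set.mem_univ _) y (Set.mem_univ _) h
  rw [(hasDerivAt_stdNormalCDF x).deriv]; exact normalDensity_le x

lemma tendsto_abs_mul_normalDensity :
    Tendsto (fun x => x * normalDensity x) atTop (𝓝 0) := by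
  have h := Real.tendsto_pow_mul_exp_neg_atTop_nhds_zero 1
  have h' : Tendsto (fun x : ℝ => (Real.sqrt (2 * Real.pi))⁻¹ * (x ^ 1 * Real.exp (-x)))
      atTop (𝓝 0) := by simpa using h.const_mul (Real.sqrt (2 * Real.pi))⁻¹
  refine squeeze_zero' ?_ ?_ h'
  · filter_upwards [eventually_ge_atTop 0] with x hx
    exact mul_nonneg hx (normalDensity_pos x).le
  · filter_upwards [eventually_ge_atTop 2] with x hx
    have : Real.exp (-(x ^ 2) / 2) ≤ Real.exp (-x) := Real.exp_le_exp.2 (by nlinarith)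
    unfold normalDensity
    rw [pow_one, mul_left_comm]
    gcongr

lemma tendsto_normalDensity : Tendsto normalDensity atTop (𝓝 0) := by
  refine squeeze_zero' ?_ ?_ tendsto_abs_mul_normalDensity
  · filter_upwards with x using (normalDensity_pos x).le
  · filter_upwards [eventually_ge_atTop 1] with x hx
    nlinarith [normalDensity_pos x]

/-- Mills' upper bound for the Gaussian tail. -/
lemma mul_stdNormalCDF_neg_le (x : ℝ) : x * stdNormalCDF (-x) ≤ normalDensity x := by
  rcases le_or_gt x 0 with hx | hx
  · nlinarith [stdNormalCDF_nonneg (-x), normalDensity_pos x]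
  have hd : ∀ y ∈ Set.Ici x, HasDerivAt (fun z => -normalDensity z) (y * normalDensity y) y :=
    fun y _ => (hasDerivAt_normalDensity y).neg.congr_deriv (by ring)
  have hpos : ∀ y ∈ Set.Ioi x, 0 ≤ y * normalDensity y := fun y hy =>
    mul_nonneg (hx.trans hy).le (normalDensity_pos y).le
  have hlim : Tendsto (fun z => -normalDensity z) atTop (𝓝 0) := by
    simpa using tendsto_normalDensity.neg
  have h1 := integral_Ioi_of_hasDerivAt_of_nonneg' hd hpos hlim
  have h2 := integrableOn_Ioi_deriv_of_nonneg' hd hpos hlim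
  have h3 : stdNormalCDF (-x) = ∫ y in Set.Ioi x, normalDensity y := by
    rw [stdNormalCDF_eq_integral, ← integral_comp_neg_Ioi]
    simp [normalDensity_neg]
  have h4 : ∫ y in Set.Ioi x, x * normalDensity y ≤ ∫ y in Set.Ioi x, y * normalDensity y := by
    refine setIntegral_mono_on (integrable_normalDensity.const_mul x).integrableOn h2
      measurableSet_Ioi fun y hy => ?_
    exact mul_le_mul_of_nonneg_right (le_of_lt hy) (normalDensity_pos y).le
  rw [integral_const_mul, ← h3, h1] at h4
  linarith

lemma tendsto_mul_stdNormalCDF_neg :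
    Tendsto (fun x => x * stdNormalCDF (-x)) atTop (𝓝 0) := by
  refine squeeze_zero' ?_ ?_ tendsto_normalDensity
  · filter_upwards [eventually_ge_atTop 0] with x hx
    exact mul_nonneg hx (stdNormalCDF_nonneg _)
  · filter_upwards with x using mul_stdNormalCDF_neg_le x

lemma hasDerivAt_stdNormalCDF_neg (x : ℝ) :
    HasDerivAt (fun y => stdNormalCDF (-y)) (-normalDensity x) x := by
  have := (hasDerivAt_stdNormalCDF (-x)).comp x (hasDerivAt_neg x)
  exact this.congr_deriv (by rw [normalDensity_neg]; ring)

lemma hasDerivAt_tail_primitive (x : ℝ) :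
    HasDerivAt (fun y => y * stdNormalCDF (-y) - normalDensity y) (stdNormalCDF (-x)) x := by
  have := ((hasDerivAt_id x).mul (hasDerivAt_stdNormalCDF_neg x)).sub (hasDerivAt_normalDensity x)
  exact this.congr_deriv (by simp)

lemma tendsto_tail_primitive :
    Tendsto (fun y => y * stdNormalCDF (-y) - normalDensity y) atTop (𝓝 0) := by
  simpa using tendsto_mul_stdNormalCDF_neg.sub tendsto_normalDensity

lemma integrableOn_stdNormalCDF_neg (w : ℝ) :
    IntegrableOn (fun t => stdNormalCDF (-t)) (Set.Ioi w) :=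
  integrableOn_Ioi_deriv_of_nonneg' (fun x _ => hasDerivAt_tail_primitive x)
    (fun _ _ => stdNormalCDF_nonneg _) tendsto_tail_primitive

lemma integral_stdNormalCDF_neg (w : ℝ) :
    ∫ t in Set.Ioi w, stdNormalCDF (-t) = normalDensity w - w * stdNormalCDF (-w) := by
  rw [integral_Ioi_of_hasDerivAt_of_nonneg' (fun x _ => hasDerivAt_tail_primitive x)
    (fun _ _ => stdNormalCDF_nonneg _) tendsto_tail_primitive]
  ring

lemma integrableOn_stdNormalCDF (w : ℝ) : IntegrableOn stdNormalCDF (Set.Iic w) := by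
  have h := integrableOn_stdNormalCDF_neg (-w)
  have := (MeasurePreserving.integrableOn_comp_preimage
    (Measure.measurePreserving_neg (volume : Measure ℝ)) (Homeomorph.neg ℝ).measurableEmbedding
    (f := fun t => stdNormalCDF (-t)) (s := Set.Ioi (-w))).2 h
  have h2 : (fun t => stdNormalCDF (-t)) ∘ (Homeomorph.neg ℝ) = stdNormalCDF := by
    ext; simp
  have h3 : (Homeomorph.neg ℝ) ⁻¹' (Set.Ioi (-w)) = Set.Iio w := by ext; simp
  have h4 : IntegrableOn stdNormalCDF (Set.Iio w) := by
    rw [← h3, ← h2]; exact this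
  rwa [integrableOn_Iic_iff_integrableOn_Iio]

lemma integral_stdNormalCDF (w : ℝ) :
    ∫ t in Set.Iic w, stdNormalCDF t = normalDensity w + w * stdNormalCDF w := by
  have h := integral_comp_neg_Ioi (-w) stdNormalCDF
  rw [neg_neg] at h
  rw [← h, integral_stdNormalCDF_neg, normalDensity_neg, neg_neg]
  ring

/-- Mills' lower bound for the Gaussian tail. -/
lemma mul_normalDensity_le (x : ℝ) :
    x * normalDensity x ≤ (1 + x ^ 2) * stdNormalCDF (-x) := by
  set k : ℝ → ℝ := fun y => (1 + y ^ 2) * stdNormalCDF (-y) - y * normalDensity y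
  have hk : ∀ y, HasDerivAt k (2 * (y * stdNormalCDF (-y) - normalDensity y)) y := fun y => by
    have h1 := (((hasDerivAt_pow 2 y).const_add 1).mul (hasDerivAt_stdNormalCDF_neg y)).sub
      ((hasDerivAt_id y).mul (hasDerivAt_normalDensity y))
    refine h1.congr_deriv ?_
    simp; ring
  have hanti : Antitone k := antitone_of_deriv_nonpos (fun y => (hk y).differentiableAt)
    fun y => by rw [(hk y).deriv]; linarith [mul_stdNormalCDF_neg_le y]
  have hle : Tendsto (fun y => -(y * normalDensity y)) atTop (𝓝 0) := by
    simpa using tendsto_abs_mul_normalDensity.neg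
  have hx : 0 ≤ k x := by
    refine le_of_tendsto hle ?_
    filter_upwards [eventually_ge_atTop x] with y hy
    refine le_trans ?_ (hanti hy)
    have : 0 ≤ (1 + y ^ 2) * stdNormalCDF (-y) :=
      mul_nonneg (by positivity) (stdNormalCDF_nonneg _)
    simp only [k]; linarith
  simp only [k] at hx; linarith


/-! ### The Stein solution for a half-line indicator -/

/-- The ratio of the normal distribution function to the normal density. -/
noncomputable def millsRatio (x : ℝ) : ℝ := stdNormalCDF x / normalDensity x

lemma millsRatio_nonneg (x : ℝ) : 0 ≤ millsRatio x :=
  div_nonneg (stdNormalCDF_nonneg x) (normalDensity_pos x).le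

lemma hasDerivAt_millsRatio (x : ℝ) : HasDerivAt millsRatio (1 + x * millsRatio x) x := by
  have := (hasDerivAt_stdNormalCDF x).div (hasDerivAt_normalDensity x) (normalDensity_pos x).ne'
  refine this.congr_deriv ?_
  have := (normalDensity_pos x).ne'
  unfold millsRatio
  field_simp
  ring

lemma continuous_millsRatio : Continuous millsRatio :=
  continuous_iff_continuousAt.2 fun x => (hasDerivAt_millsRatio x).continuousAt

lemma neg_one_le_mul_millsRatio (x : ℝ) : -1 ≤ x * millsRatio x := by
  have h := mul_stdNormalCDF_neg_le (-x)
  rw [neg_neg, normalDensity_neg] at h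
  unfold millsRatio
  rw [mul_div_assoc', le_div_iff₀ (normalDensity_pos x)]
  linarith

lemma monotone_mul_millsRatio : Monotone fun x => x * millsRatio x := by
  have hd : ∀ x, HasDerivAt (fun x => x * millsRatio x)
      (millsRatio x + x * (1 + x * millsRatio x)) x := fun x =>
    ((hasDerivAt_id x).mul (hasDerivAt_millsRatio x)).congr_deriv (by simp)
  refine monotone_of_deriv_nonneg (fun x => (hd x).differentiableAt) fun x => ?_
  rw [(hd x).deriv]
  have h := mul_normalDensity_le (-x)
  rw [neg_neg, normalDensity_neg] at h
  have h0 := normalDensity_pos x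
  have : millsRatio x + x * (1 + x * millsRatio x)
      = ((1 + (-x) ^ 2) * stdNormalCDF x - -x * normalDensity x) / normalDensity x := by
    unfold millsRatio
    field_simp
    ring
  rw [this]
  exact div_nonneg (by linarith) h0.le

/-- The bounded solution of Stein's equation for the indicator of `(-∞, t]`. -/
noncomputable def steinSol (t w : ℝ) : ℝ :=
  if w ≤ t then stdNormalCDF (-t) * millsRatio w else stdNormalCDF t * millsRatio (-w)

/-- The derivative of `steinSol t`, as given by Stein's equation. -/
noncomputable def steinDeriv (t w : ℝ) : ℝ :=
  w * steinSol t w + (if w ≤ t then 1 else 0) - stdNormalCDF t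

lemma steinSol_of_le {t w : ℝ} (h : w ≤ t) :
    steinSol t w = stdNormalCDF (-t) * millsRatio w := if_pos h

lemma steinSol_of_ge {t w : ℝ} (h : t ≤ w) :
    steinSol t w = stdNormalCDF t * millsRatio (-w) := by
  rcases h.lt_or_eq with h | rfl
  · exact if_neg (not_le.2 h)
  · rw [steinSol_of_le le_rfl]
    unfold millsRatio
    rw [normalDensity_neg]; ring

lemma steinSol_nonneg (t w : ℝ) : 0 ≤ steinSol t w := by
  unfold steinSol
  split_ifs <;> exact mul_nonneg (stdNormalCDF_nonneg _) (millsRatio_nonneg _)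

lemma monotone_mul_steinSol (t : ℝ) : Monotone fun w => w * steinSol t w := by
  refine MonotoneOn.Iic_union_Ici (a := t) ?_ ?_
  · intro x hx y hy hxy
    simp only [steinSol_of_le (Set.mem_Iic.1 hx), steinSol_of_le (Set.mem_Iic.1 hy)]
    have := monotone_mul_millsRatio hxy
    nlinarith [stdNormalCDF_nonneg (-t)]
  · intro x hx y hy hxy
    simp only [steinSol_of_ge (Set.mem_Ici.1 hx), steinSol_of_ge (Set.mem_Ici.1 hy)]
    have := monotone_mul_millsRatio (neg_le_neg hxy)
    nlinarith [stdNormalCDF_nonneg t]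

lemma abs_mul_steinSol_le (t w : ℝ) : |w * steinSol t w| ≤ 1 := by
  rw [abs_le]
  constructor
  · refine le_trans ?_ (monotone_mul_steinSol t (min_le_left w t))
    simp only [steinSol_of_le (min_le_right w t)]
    nlinarith [neg_one_le_mul_millsRatio (min w t), stdNormalCDF_nonneg (-t),
      stdNormalCDF_le_one (-t)]
  · refine le_trans (monotone_mul_steinSol t (le_max_left w t)) ?_
    simp only [steinSol_of_ge (le_max_right w t)]
    nlinarith [neg_one_le_mul_millsRatio (-(max w t)), stdNormalCDF_nonneg t,
      stdNormalCDF_le_one t]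

lemma continuous_steinSol_right (t : ℝ) : Continuous (steinSol t) := by
  refine Continuous.if_le (continuous_const.mul continuous_millsRatio)
    (continuous_const.mul (continuous_millsRatio.comp continuous_neg)) continuous_id
    continuous_const fun x hx => ?_
  rw [← steinSol_of_le (t := t) (le_of_eq hx), ← steinSol_of_ge (t := t) (le_of_eq hx.symm)]

lemma hasDerivAt_steinSol {t w : ℝ} (h : w ≠ t) :
    HasDerivAt (steinSol t) (steinDeriv t w) w := by
  rcases h.lt_or_gt with h | h
  · have h1 := (hasDerivAt_millsRatio w).const_mul (stdNormalCDF (-t))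
    refine (h1.congr_of_eventuallyEq ?_).congr_deriv ?_
    · filter_upwards [Iio_mem_nhds h] with x hx using steinSol_of_le (le_of_lt hx)
    · rw [steinDeriv, if_pos h.le, steinSol_of_le h.le, stdNormalCDF_neg]; ring
  · have h1 := (((hasDerivAt_millsRatio (-w)).comp w (hasDerivAt_neg w))).const_mul (stdNormalCDF t)
    refine (h1.congr_of_eventuallyEq ?_).congr_deriv ?_
    · filter_upwards [Ioi_mem_nhds h] with x hx using steinSol_of_ge (le_of_lt hx)
    · rw [steinDeriv, if_neg (not_le.2 h), steinSol_of_ge h.le]; ring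

/-- The oscillation of `steinDeriv t` between `w` and `w + d`, split into its monotone and
its jump part. -/
noncomputable def steinOsc (t w d : ℝ) : ℝ :=
  |(w + d) * steinSol t (w + d) - w * steinSol t w|
    + |(if w + d ≤ t then (1 : ℝ) else 0) - (if w ≤ t then 1 else 0)|

lemma antitone_indicator_le (t : ℝ) : Antitone fun w : ℝ => if w ≤ t then (1 : ℝ) else 0 := by
  intro x y hxy
  dsimp only
  split_ifs <;> linarith

lemma intervalIntegrable_steinDeriv (t x y : ℝ) :
    IntervalIntegrable (steinDeriv t) volume x y := by
  have h1 : IntervalIntegrable (fun w => w * steinSol t w) volume x y :=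
    (monotone_mul_steinSol t).intervalIntegrable
  have h2 : IntervalIntegrable (fun w : ℝ => if w ≤ t then (1 : ℝ) else 0) volume x y :=
    (antitone_indicator_le t).intervalIntegrable
  exact (h1.add h2).sub intervalIntegrable_const

lemma integral_steinDeriv (t x y : ℝ) :
    ∫ w in x..y, steinDeriv t w = steinSol t y - steinSol t x :=
  integral_eq_of_hasDerivAt_off_countable _ _ (Set.countable_singleton t)
    (continuous_steinSol_right t).continuousOn (fun _ hv => hasDerivAt_steinSol hv.2)
    (intervalIntegrable_steinDeriv t x y)

lemma abs_sub_le_of_mem_uIcc_of_monotone {f : ℝ → ℝ} (hf : Monotone f) {x y v : ℝ}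
    (hv : v ∈ Set.uIcc x y) : |f v - f x| ≤ |f y - f x| := by
  rcases le_total x y with h | h
  · rw [Set.uIcc_of_le h] at hv
    have h1 := hf hv.1
    have h2 := hf hv.2
    rw [abs_of_nonneg (by linarith), abs_of_nonneg (by linarith)]; linarith
  · rw [Set.uIcc_of_ge h] at hv
    have h1 := hf hv.1
    have h2 := hf hv.2
    rw [abs_of_nonpos (by linarith), abs_of_nonpos (by linarith)]; linarith

lemma abs_steinSol_taylor_le (t w d : ℝ) :
    |steinSol t (w + d) - steinSol t w - d * steinDeriv t w| ≤ |d| * steinOsc t w d := by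
  have h : steinSol t (w + d) - steinSol t w - d * steinDeriv t w
      = ∫ v in w..w + d, (steinDeriv t v - steinDeriv t w) := by
    rw [intervalIntegral.integral_sub (intervalIntegrable_steinDeriv t _ _)
      intervalIntegrable_const, integral_steinDeriv, intervalIntegral.integral_const]
    simp
  rw [h, ← Real.norm_eq_abs]
  have := intervalIntegral.norm_integral_le_of_norm_le_const (a := w) (b := w + d)
    (C := steinOsc t w d) (f := fun v => steinDeriv t v - steinDeriv t w) fun v hv => ?_
  · rw [add_sub_cancel_left] at this
    linarith
  have hv' := Set.uIoc_subset_uIcc hv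
  have h1 := abs_sub_le_of_mem_uIcc_of_monotone (monotone_mul_steinSol t) hv'
  have h2 := abs_sub_le_of_mem_uIcc_of_monotone (antitone_indicator_le t).neg hv'
  simp only [← neg_sub', abs_neg] at h2
  have h3 : steinDeriv t v - steinDeriv t w = (v * steinSol t v - w * steinSol t w)
      + ((if v ≤ t then (1 : ℝ) else 0) - (if w ≤ t then 1 else 0)) := by
    unfold steinDeriv; ring
  rw [h3, Real.norm_eq_abs]
  exact (abs_add_le _ _).trans (add_le_add h1 h2)

lemma abs_indicator_sub_stdNormalCDF_le (t w : ℝ) :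
    |(if w ≤ t then (1 : ℝ) else 0) - stdNormalCDF t| ≤ 1 := by
  have h1 := stdNormalCDF_nonneg t
  have h2 := stdNormalCDF_le_one t
  split_ifs <;> rw [abs_le] <;> constructor <;> linarith

lemma abs_steinDeriv_le (t w : ℝ) : |steinDeriv t w| ≤ 2 := by
  unfold steinDeriv
  rw [add_sub_assoc]
  linarith [abs_add_le (w * steinSol t w) ((if w ≤ t then (1 : ℝ) else 0) - stdNormalCDF t),
    abs_mul_steinSol_le t w, abs_indicator_sub_stdNormalCDF_le t w]

lemma abs_steinSol_sub_le (t x y : ℝ) : |steinSol t y - steinSol t x| ≤ 2 * |y - x| := by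
  rw [← integral_steinDeriv, ← Real.norm_eq_abs]
  exact intervalIntegral.norm_integral_le_of_norm_le_const fun v _ => abs_steinDeriv_le t v

lemma steinSol_le (t w : ℝ) : steinSol t w ≤ 3 := by
  have key : ∀ e : ℝ, |e| = 1 → steinSol t e ≤ 1 := fun e he => by
    have := abs_mul_steinSol_le t e
    rw [abs_mul, he, one_mul] at this
    exact (le_abs_self _).trans this
  rcases le_total 0 w with h | h
  · rcases le_total 1 w with h1 | h1
    · have := (le_abs_self _).trans (abs_mul_steinSol_le t w)
      nlinarith [steinSol_nonneg t w]
    · have h2 := (le_abs_self _).trans (abs_steinSol_sub_le t 1 w)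
      rw [abs_of_nonpos (by linarith)] at h2
      linarith [key 1 (by simp)]
  · rcases le_total w (-1) with h1 | h1
    · have := (neg_le_abs _).trans (abs_mul_steinSol_le t w)
      nlinarith [steinSol_nonneg t w]
    · have h2 := (le_abs_self _).trans (abs_steinSol_sub_le t (-1) w)
      rw [abs_of_nonneg (by linarith)] at h2
      linarith [key (-1) (by simp)]

lemma abs_mul_steinSol_sub_le (t w₀ c d : ℝ) :
    |(w₀ + c + d) * steinSol t (w₀ + c + d) - (w₀ + c) * steinSol t (w₀ + c)|
      ≤ |d| * (2 * |w₀| + 5) + 2 * |c| := by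
  set w := w₀ + c
  rcases le_total |c| 1 with h | h
  · have h1 : (w + d) * steinSol t (w + d) - w * steinSol t w
        = w * (steinSol t (w + d) - steinSol t w) + d * steinSol t (w + d) := by ring
    have h2 := abs_steinSol_sub_le t w (w + d)
    rw [add_sub_cancel_left] at h2
    have h3 : |steinSol t (w + d)| ≤ 3 := by
      rw [abs_of_nonneg (steinSol_nonneg _ _)]; exact steinSol_le _ _
    have h4 : |w| ≤ |w₀| + 1 := (abs_add_le _ _).trans (by linarith)
    calc _ ≤ |w| * |steinSol t (w + d) - steinSol t w| + |d| * |steinSol t (w + d)| := by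
          rw [h1, ← abs_mul, ← abs_mul]; exact abs_add_le _ _
      _ ≤ (|w₀| + 1) * (2 * |d|) + |d| * 3 := by gcongr
      _ ≤ _ := by nlinarith [abs_nonneg c]
  · have h1 := abs_mul_steinSol_le t (w + d)
    have h2 := abs_mul_steinSol_le t w
    have h3 := abs_sub ((w + d) * steinSol t (w + d)) (w * steinSol t w)
    nlinarith [abs_nonneg d, abs_nonneg w₀, mul_nonneg (abs_nonneg d) (abs_nonneg w₀)]

lemma integrable_steinSol (w : ℝ) : Integrable fun t => steinSol t w := by
  rw [← integrableOn_univ, ← Set.Iic_union_Ioi (a := w)]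
  refine IntegrableOn.union ?_ ?_
  · exact (integrableOn_congr_fun (fun t ht => steinSol_of_ge ht) measurableSet_Iic).2
      ((integrableOn_stdNormalCDF w).mul_const _)
  · exact (integrableOn_congr_fun (fun t ht => steinSol_of_le (le_of_lt ht)) measurableSet_Ioi).2
      ((integrableOn_stdNormalCDF_neg w).mul_const _)

lemma integral_steinSol (w : ℝ) : ∫ t, steinSol t w = 1 := by
  rw [← intervalIntegral.integral_Iic_add_Ioi (integrable_steinSol w).integrableOn
    (integrable_steinSol w).integrableOn (b := w),
    setIntegral_congr_fun measurableSet_Iic (fun t ht => steinSol_of_ge ht),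
    setIntegral_congr_fun measurableSet_Ioi (fun t ht => steinSol_of_le (le_of_lt ht)),
    integral_mul_const, integral_mul_const, integral_stdNormalCDF, integral_stdNormalCDF_neg,
    stdNormalCDF_neg]
  have := (normalDensity_pos w).ne'
  unfold millsRatio
  rw [stdNormalCDF_neg, normalDensity_neg]
  field_simp
  ring

lemma integrable_indicator_sub_stdNormalCDF (w : ℝ) :
    Integrable fun t => (if w ≤ t then (1 : ℝ) else 0) - stdNormalCDF t := by
  rw [← integrableOn_univ, ← Set.Iio_union_Ici (a := w)]
  refine IntegrableOn.union ?_ ?_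
  · refine (integrableOn_congr_fun (g := fun t => -stdNormalCDF t) (fun t ht => ?_)
      measurableSet_Iio).2 ((integrableOn_stdNormalCDF w).mono_set Set.Iio_subset_Iic_self).neg
    simp [not_le.2 (Set.mem_Iio.1 ht)]
  · rw [integrableOn_Ici_iff_integrableOn_Ioi]
    refine (integrableOn_congr_fun (fun t ht => ?_) measurableSet_Ioi).2
      (integrableOn_stdNormalCDF_neg w)
    simp [le_of_lt (Set.mem_Ioi.1 ht), stdNormalCDF_neg]

lemma integral_abs_indicator_sub_stdNormalCDF_le (w : ℝ) :
    ∫ t, |(if w ≤ t then (1 : ℝ) else 0) - stdNormalCDF t| ≤ |w| + 1 := by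
  have hI := (integrable_indicator_sub_stdNormalCDF w).abs
  rw [← intervalIntegral.integral_Iio_add_Ici hI.integrableOn hI.integrableOn (b := w),
    setIntegral_congr_fun (g := stdNormalCDF) measurableSet_Iio (fun t ht => ?_),
    setIntegral_congr_fun (g := fun t => stdNormalCDF (-t)) measurableSet_Ici (fun t ht => ?_),
    ← integral_Iic_eq_integral_Iio, integral_Ici_eq_integral_Ioi, integral_stdNormalCDF,
    integral_stdNormalCDF_neg]
  · have h1 := stdNormalCDF_nonneg w
    have h2 := stdNormalCDF_le_one w
    have h3 := normalDensity_le w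
    have h4 : w * (2 * stdNormalCDF w - 1) ≤ |w| := by
      refine (le_abs_self _).trans ?_
      rw [abs_mul]
      exact mul_le_of_le_one_right (abs_nonneg w) (abs_le.2 ⟨by linarith, by linarith⟩)
    rw [stdNormalCDF_neg]
    linarith
  · have := stdNormalCDF_le_one t
    simp only [if_pos (Set.mem_Ici.1 ht), stdNormalCDF_neg]
    exact abs_of_nonneg (by linarith)
  · simp only [if_neg (not_le.2 (Set.mem_Iio.1 ht)), zero_sub, abs_neg]
    exact abs_of_nonneg (stdNormalCDF_nonneg t)

lemma integrable_steinDeriv (w : ℝ) : Integrable fun t => steinDeriv t w := by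
  have := ((integrable_steinSol w).const_mul w).add (integrable_indicator_sub_stdNormalCDF w)
  refine this.congr (Eventually.of_forall fun t => ?_)
  simp [steinDeriv, add_sub_assoc]

lemma integral_abs_steinDeriv_le (w : ℝ) : ∫ t, |steinDeriv t w| ≤ 2 * |w| + 1 := by
  have h1 : Integrable fun t => |w| * steinSol t w := (integrable_steinSol w).const_mul _
  have h2 := (integrable_indicator_sub_stdNormalCDF w).abs
  calc _ ≤ ∫ t, (|w| * steinSol t w + |(if w ≤ t then (1 : ℝ) else 0) - stdNormalCDF t|) := by
        refine integral_mono (integrable_steinDeriv w).abs (h1.add h2) fun t => ?_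
        simp only [steinDeriv, add_sub_assoc]
        refine (abs_add_le _ _).trans (add_le_add (le_of_eq ?_) le_rfl)
        rw [abs_mul, abs_of_nonneg (steinSol_nonneg t w)]
    _ ≤ _ := by
        rw [integral_add h1 h2, integral_const_mul, integral_steinSol]
        linarith [integral_abs_indicator_sub_stdNormalCDF_le w]

lemma integrable_indicator_sub_indicator (x y : ℝ) :
    Integrable fun t => (if x ≤ t then (1 : ℝ) else 0) - (if y ≤ t then 1 else 0) := by
  refine ((integrable_indicator_sub_stdNormalCDF x).sub
    (integrable_indicator_sub_stdNormalCDF y)).congr (Eventually.of_forall fun t => ?_)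
  simp

lemma integral_abs_indicator_sub_indicator (x y : ℝ) :
    ∫ t, |(if x ≤ t then (1 : ℝ) else 0) - (if y ≤ t then 1 else 0)| = |x - y| := by
  wlog h : x ≤ y generalizing x y
  · rw [abs_sub_comm x y, ← this y x (not_le.1 h).le]
    simp_rw [abs_sub_comm]
  have : ∀ t, |(if x ≤ t then (1 : ℝ) else 0) - (if y ≤ t then 1 else 0)|
      = (Set.Ico x y).indicator 1 t := fun t => by
    by_cases h1 : x ≤ t <;> by_cases h2 : y ≤ t <;>
      simp [Set.indicator, h1, h2]
    exact h1 (h.trans h2)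
  simp_rw [this]
  rw [integral_indicator_one measurableSet_Ico, abs_sub_comm, abs_of_nonneg (by linarith)]
  simp [h]

lemma integrable_steinOsc (w d : ℝ) : Integrable fun t => steinOsc t w d :=
  ((((integrable_steinSol (w + d)).const_mul _).sub ((integrable_steinSol w).const_mul w)).abs).add
    (integrable_indicator_sub_indicator (w + d) w).abs

lemma integral_steinOsc_le (w d : ℝ) : ∫ t, steinOsc t w d ≤ 2 * |d| := by
  unfold steinOsc
  have h1 : Integrable fun t => (w + d) * steinSol t (w + d) - w * steinSol t w :=
    ((integrable_steinSol (w + d)).const_mul _).sub ((integrable_steinSol w).const_mul w)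
  rw [integral_add h1.abs (integrable_indicator_sub_indicator (w + d) w).abs,
    integral_abs_indicator_sub_indicator]
  have h3 : ∫ t, ((w + d) * steinSol t (w + d) - w * steinSol t w) = d := by
    rw [integral_sub ((integrable_steinSol (w + d)).const_mul _)
      ((integrable_steinSol w).const_mul w), integral_const_mul, integral_const_mul,
      integral_steinSol, integral_steinSol]
    ring
  have h2 : ∫ t, |(w + d) * steinSol t (w + d) - w * steinSol t w| = |d| := by
    rcases le_total 0 d with hd | hd
    · refine Eq.trans ?_ (h3.trans (abs_of_nonneg hd).symm)
      refine integral_congr_ae (Eventually.of_forall fun t => abs_of_nonneg ?_)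
      exact sub_nonneg.2 (monotone_mul_steinSol t (by linarith))
    · refine Eq.trans ?_ ((congrArg Neg.neg h3).trans (abs_of_nonpos hd).symm)
      rw [← integral_neg]
      refine integral_congr_ae (Eventually.of_forall fun t => abs_of_nonpos ?_)
      exact sub_nonpos.2 (monotone_mul_steinSol t (by linarith))
  rw [h2, add_sub_cancel_left]
  linarith

/-! ### Random perfect matchings -/

set_option linter.unusedSectionVars false

section Matchings

variable {V : Type*} [Fintype V] [DecidableEq V]

/-- The perfect matchings of `s`, as involutions whose set of fixed points is the complement
of `s`. -/
def matchings (s : Finset V) : Finset (Equiv.Perm V) :=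
  univ.filter fun π => (∀ v, π (π v) = v) ∧ ∀ v, π v = v ↔ v ∉ s

lemma mem_matchings {s : Finset V} {π : Equiv.Perm V} :
    π ∈ matchings s ↔ (∀ v, π (π v) = v) ∧ ∀ v, π v = v ↔ v ∉ s := by
  simp [matchings]

lemma matchings_apply_apply {s : Finset V} {π : Equiv.Perm V} (h : π ∈ matchings s) (v : V) :
    π (π v) = v := (mem_matchings.1 h).1 v

lemma matchings_apply_ne {s : Finset V} {π : Equiv.Perm V} (h : π ∈ matchings s) {v : V}
    (hv : v ∈ s) : π v ≠ v := fun h' => ((mem_matchings.1 h).2 v).1 h' hv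

lemma matchings_apply_mem {s : Finset V} {π : Equiv.Perm V} (h : π ∈ matchings s) {v : V}
    (hv : v ∈ s) : π v ∈ s := by
  by_contra h'
  exact matchings_apply_ne h hv (by
    have := ((mem_matchings.1 h).2 (π v)).2 h'
    rwa [matchings_apply_apply h, eq_comm] at this)

lemma sum_comp_matching {s : Finset V} {π : Equiv.Perm V} (h : π ∈ matchings s) (g : V → ℝ) :
    ∑ i ∈ s, g (π i) = ∑ i ∈ s, g i :=
  sum_bij' (fun i _ => π i) (fun i _ => π i) (fun _ hi => matchings_apply_mem h hi)
    (fun _ hi => matchings_apply_mem h hi) (fun i _ => matchings_apply_apply h i)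
    (fun i _ => matchings_apply_apply h i) (fun _ _ => rfl)

lemma swap_conj_mem_matchings {s : Finset V} {π : Equiv.Perm V} (h : π ∈ matchings s) {k l : V}
    (hk : k ∈ s) (hl : l ∈ s) : Equiv.swap k l * π * Equiv.swap k l ∈ matchings s := by
  have hs : ∀ v, Equiv.swap k l v ∈ s ↔ v ∈ s := fun v => by
    rcases eq_or_ne v k with rfl | h1
    · simp [hk, hl]
    rcases eq_or_ne v l with rfl | h2
    · simp [hk, hl]
    rw [Equiv.swap_apply_of_ne_of_ne h1 h2]
  refine mem_matchings.2 ⟨fun v => ?_, fun v => ?_⟩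
  · simp [matchings_apply_apply h]
  · rw [← hs v, ← (mem_matchings.1 h).2, Equiv.Perm.mul_apply, Equiv.Perm.mul_apply,
      Equiv.swap_apply_eq_iff]

/-- The matching obtained from `π` by matching `i` with `k`, and their former partners with each
other. -/
def rematch (i k : V) (π : Equiv.Perm V) : Equiv.Perm V :=
  Equiv.swap k (π i) * π * Equiv.swap k (π i)

lemma rematch_mem_matchings {s : Finset V} {π : Equiv.Perm V} (h : π ∈ matchings s) {i k : V}
    (hi : i ∈ s) (hk : k ∈ s) : rematch i k π ∈ matchings s :=
  swap_conj_mem_matchings h hk (matchings_apply_mem h hi)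

lemma sum_rematch {s : Finset V} {i k : V} (hi : i ∈ s) (hk : k ∈ s) (hik : i ≠ k)
    (g : Equiv.Perm V → ℝ) :
    ∑ π ∈ matchings s, g (rematch i k π)
      = ((#s : ℝ) - 1) * ∑ π ∈ matchings s with π i = k, g π := by
  have hmaps : ∀ π ∈ matchings s, π i ∈ s.erase i := fun π hπ =>
    mem_erase.2 ⟨matchings_apply_ne hπ hi, matchings_apply_mem hπ hi⟩
  rw [← sum_fiberwise_of_maps_to hmaps]
  have hfib : ∀ l ∈ s.erase i, ∑ π ∈ matchings s with π i = l, g (rematch i k π)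
      = ∑ π ∈ matchings s with π i = k, g π := fun l hl => by
    obtain ⟨hli, hl⟩ := mem_erase.1 hl
    refine sum_bij' (fun π _ => Equiv.swap k l * π * Equiv.swap k l)
      (fun π _ => Equiv.swap k l * π * Equiv.swap k l) ?_ ?_ ?_ ?_ ?_
    · intro π hπ
      obtain ⟨h1, h2⟩ := mem_filter.1 hπ
      refine mem_filter.2 ⟨swap_conj_mem_matchings h1 hk hl, ?_⟩
      simp [Equiv.swap_apply_of_ne_of_ne hik hli.symm, h2]
    · intro π hπ
      obtain ⟨h1, h2⟩ := mem_filter.1 hπ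
      refine mem_filter.2 ⟨swap_conj_mem_matchings h1 hk hl, ?_⟩
      simp [Equiv.swap_apply_of_ne_of_ne hik hli.symm, h2]
    · intro π _; ext v; simp
    · intro π _; ext v; simp
    · intro π hπ
      rw [rematch, (mem_filter.1 hπ).2]
  rw [sum_congr rfl hfib, sum_const, card_erase_of_mem hi, nsmul_eq_mul,
    Nat.cast_sub (card_pos.2 ⟨i, hi⟩)]
  simp

lemma mul_swap_mem_matchings {s : Finset V} {i k : V} (hi : i ∈ s) (hk : k ∈ s) (hik : i ≠ k)
    {ρ : Equiv.Perm V} (h : ρ ∈ matchings ((s.erase i).erase k)) :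
    ρ * Equiv.swap i k ∈ matchings s := by
  have h1 : ρ i = i := ((mem_matchings.1 h).2 i).2 (by simp)
  have h2 : ρ k = k := ((mem_matchings.1 h).2 k).2 (by simp)
  have h3 : ∀ v, v ≠ i → v ≠ k → ρ v ≠ i ∧ ρ v ≠ k := fun v hv1 hv2 =>
    ⟨fun h' => hv1 (ρ.injective (h'.trans h1.symm)), fun h' => hv2 (ρ.injective (h'.trans h2.symm))⟩
  refine mem_matchings.2 ⟨fun v => ?_, fun v => ?_⟩
  · rcases eq_or_ne v i with rfl | hv1
    · simp [h1, h2]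
    rcases eq_or_ne v k with rfl | hv2
    · simp [h1, h2]
    obtain ⟨h4, h5⟩ := h3 v hv1 hv2
    simp [Equiv.swap_apply_of_ne_of_ne, hv1, hv2, h4, h5, matchings_apply_apply h]
  · rcases eq_or_ne v i with rfl | hv1
    · simp [h2, hi, hik.symm]
    rcases eq_or_ne v k with rfl | hv2
    · simp [h1, hk, hik]
    have := (mem_matchings.1 h).2 v
    simp only [mem_erase, ne_eq, hv2, not_false_eq_true, hv1, true_and] at this
    simpa [Equiv.swap_apply_of_ne_of_ne, hv1, hv2] using this

lemma sum_matchings_filter {s : Finset V} {i k : V} (hi : i ∈ s) (hk : k ∈ s) (hik : i ≠ k)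
    (g : Equiv.Perm V → ℝ) :
    ∑ π ∈ matchings s with π i = k, g π
      = ∑ ρ ∈ matchings ((s.erase i).erase k), g (ρ * Equiv.swap i k) := by
  symm
  refine sum_bij' (fun ρ _ => ρ * Equiv.swap i k) (fun π _ => π * Equiv.swap i k) ?_ ?_ ?_ ?_ ?_
  · intro ρ hρ
    refine mem_filter.2 ⟨mul_swap_mem_matchings hi hk hik hρ, ?_⟩
    simpa using ((mem_matchings.1 hρ).2 k).2 (by simp)
  · intro π hπ
    obtain ⟨h, hπi⟩ := mem_filter.1 hπ
    have hπk : π k = i := by rw [← hπi]; exact matchings_apply_apply h i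
    refine mem_matchings.2 ⟨fun v => ?_, fun v => ?_⟩
    · rcases eq_or_ne v i with rfl | hv1
      · simp [hπk]
      rcases eq_or_ne v k with rfl | hv2
      · simp [hπi]
      have h4 : π v ≠ i := fun h' => hv2 (by rw [← matchings_apply_apply h v, h', hπi])
      have h5 : π v ≠ k := fun h' => hv1 (by rw [← matchings_apply_apply h v, h', hπk])
      simp [Equiv.swap_apply_of_ne_of_ne, hv1, hv2, h4, h5, matchings_apply_apply h]
    · rcases eq_or_ne v i with rfl | hv1
      · simp [hπk]
      rcases eq_or_ne v k with rfl | hv2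
      · simp [hπi]
      simpa [Equiv.swap_apply_of_ne_of_ne, hv1, hv2] using (mem_matchings.1 h).2 v
  · intro ρ _; ext v; simp
  · intro ρ _; ext v; simp
  · intro ρ _; rfl

lemma matchings_nonempty {s : Finset V} (hs : Even #s) : (matchings s).Nonempty := by
  induction s using Finset.strongInduction with
  | H s ih =>
    rcases s.eq_empty_or_nonempty with rfl | ⟨i, hi⟩
    · exact ⟨1, by simp [mem_matchings]⟩
    have h1 : 1 < #s := by
      rcases hs with ⟨m, hm⟩
      have := card_pos.2 ⟨i, hi⟩
      omega
    obtain ⟨k, hk, hki⟩ := exists_mem_ne h1 i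
    have hk' : k ∈ s.erase i := mem_erase.2 ⟨hki, hk⟩
    have hcard : #((s.erase i).erase k) = #s - 2 := by
      rw [card_erase_of_mem hk', card_erase_of_mem hi]; omega
    obtain ⟨ρ, hρ⟩ := ih _ ((erase_ssubset hk').trans (erase_ssubset hi))
      (by obtain ⟨m, hm⟩ := hs; exact ⟨m - 1, by omega⟩)
    exact ⟨_, mul_swap_mem_matchings hi hk hki.symm hρ⟩

/-- The expectation of `g` over a uniformly random perfect matching of `s`. -/
noncomputable def avg (s : Finset V) (g : Equiv.Perm V → ℝ) : ℝ :=
  (∑ π ∈ matchings s, g π) / #(matchings s)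

lemma avg_add (s : Finset V) (g h : Equiv.Perm V → ℝ) :
    avg s (fun π => g π + h π) = avg s g + avg s h := by
  simp [avg, sum_add_distrib, add_div]

lemma avg_sub (s : Finset V) (g h : Equiv.Perm V → ℝ) :
    avg s (fun π => g π - h π) = avg s g - avg s h := by
  simp [avg, sum_sub_distrib, sub_div]

lemma avg_const_mul (s : Finset V) (c : ℝ) (g : Equiv.Perm V → ℝ) :
    avg s (fun π => c * g π) = c * avg s g := by
  simp [avg, ← mul_sum, mul_div_assoc]

lemma avg_sum {ι : Type*} (s : Finset V) (t : Finset ι) (g : ι → Equiv.Perm V → ℝ) :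
    avg s (fun π => ∑ x ∈ t, g x π) = ∑ x ∈ t, avg s (g x) := by
  simp only [avg]
  rw [sum_comm, sum_div]

lemma avg_mono {s : Finset V} {g h : Equiv.Perm V → ℝ} (H : ∀ π ∈ matchings s, g π ≤ h π) :
    avg s g ≤ avg s h :=
  div_le_div_of_nonneg_right (sum_le_sum H) (Nat.cast_nonneg _)

lemma avg_congr {s : Finset V} {g h : Equiv.Perm V → ℝ} (H : ∀ π ∈ matchings s, g π = h π) :
    avg s g = avg s h := by
  unfold avg; rw [sum_congr rfl H]

lemma avg_nonneg {s : Finset V} {g : Equiv.Perm V → ℝ} (H : ∀ π ∈ matchings s, 0 ≤ g π) :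
    0 ≤ avg s g :=
  div_nonneg (sum_nonneg H) (Nat.cast_nonneg _)

lemma avg_const {s : Finset V} (hs : Even #s) (c : ℝ) : avg s (fun _ => c) = c := by
  have : (#(matchings s) : ℝ) ≠ 0 :=
    Nat.cast_ne_zero.2 (card_ne_zero.2 (matchings_nonempty hs))
  simp [avg, this]

lemma abs_avg_le (s : Finset V) (g : Equiv.Perm V → ℝ) : |avg s g| ≤ avg s fun π => |g π| := by
  unfold avg
  rw [abs_div, Nat.abs_cast]
  exact div_le_div_of_nonneg_right (abs_sum_le_sum_abs _ _) (Nat.cast_nonneg _)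

lemma sq_avg_mul_le {s : Finset V} (g h : Equiv.Perm V → ℝ) :
    avg s (fun π => g π * h π) ^ 2 ≤ avg s (fun π => g π ^ 2) * avg s (fun π => h π ^ 2) := by
  unfold avg
  rw [div_pow, div_mul_div_comm, ← sq]
  exact div_le_div_of_nonneg_right (sum_mul_sq_le_sq_mul_sq _ _ _) (by positivity)

lemma sq_avg_le {s : Finset V} (hs : Even #s) (g : Equiv.Perm V → ℝ) :
    avg s g ^ 2 ≤ avg s (fun π => g π ^ 2) := by
  simpa [avg_const hs] using sq_avg_mul_le (s := s) g (fun _ => 1)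

/-- Matching `i` with a uniformly random partner amounts to rematching. -/
lemma avg_sum_partner (s : Finset V) (H : V → V → Equiv.Perm V → ℝ) :
    ((#s : ℝ) - 1) * avg s (fun π => ∑ i ∈ s, H i (π i) π)
      = ∑ i ∈ s, ∑ k ∈ s.erase i, avg s (fun π => H i k (rematch i k π)) := by
  have key : ∀ i ∈ s, ((#s : ℝ) - 1) * ∑ π ∈ matchings s, H i (π i) π
      = ∑ k ∈ s.erase i, ∑ π ∈ matchings s, H i k (rematch i k π) := fun i hi => by
    have hmaps : ∀ π ∈ matchings s, π i ∈ s.erase i := fun π hπ =>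
      mem_erase.2 ⟨matchings_apply_ne hπ hi, matchings_apply_mem hπ hi⟩
    rw [← sum_fiberwise_of_maps_to hmaps, mul_sum]
    refine sum_congr rfl fun k hk => ?_
    obtain ⟨hki, hk⟩ := mem_erase.1 hk
    rw [sum_rematch hi hk hki.symm]
    congr 1
    refine sum_congr rfl fun π hπ => ?_
    rw [(mem_filter.1 hπ).2]
  simp only [avg]
  rw [sum_comm, ← mul_div_assoc, mul_sum, sum_congr rfl key, sum_div]
  simp only [sum_div]

lemma avg_sum_apply (s : Finset V) (hs : Even #s) (φ : V → V → ℝ) :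
    ((#s : ℝ) - 1) * avg s (fun π => ∑ i ∈ s, φ i (π i)) = ∑ i ∈ s, ∑ k ∈ s.erase i, φ i k := by
  rw [avg_sum_partner s fun i k _ => φ i k]
  simp [avg_const hs]

lemma rematch_eq_self {i k : V} {π : Equiv.Perm V} (h : π i = k) : rematch i k π = π := by
  ext v; simp [rematch, h]

/-- Effect of rematching on a sum over the matched pairs. -/
lemma sum_rematch_apply {s : Finset V} {π : Equiv.Perm V} (h : π ∈ matchings s) {i k : V}
    (hi : i ∈ s) (hk : k ∈ s) (hik : i ≠ k) (g : V → V → ℝ) :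
    ∑ p ∈ s, g p (rematch i k π p) = ∑ p ∈ s, g p (π p) + (g i k - g i (π i)) + (g k i - g k (π k))
      + (g (π i) (π k) - g (π i) i) + (g (π k) (π i) - g (π k) k) := by
  have hinv := matchings_apply_apply h
  rcases eq_or_ne (π i) k with hl | hl
  · have hm : π k = i := by rw [← hl, hinv]
    rw [rematch_eq_self hl, hl, hm]; ring
  set l := π i with hl_def
  set m := π k with hm_def
  have hli : l ≠ i := matchings_apply_ne h hi
  have hmk : m ≠ k := matchings_apply_ne h hk
  have hml : m ≠ l := fun h' => hik (π.injective h').symm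
  have hmi : m ≠ i := fun h' => hl (by rw [hl_def, ← h', hm_def, hinv])
  have hπl : π l = i := hinv i
  have hπm : π m = k := hinv k
  have e1 : rematch i k π i = k := by
    simp [rematch, ← hl_def, Equiv.swap_apply_of_ne_of_ne hik hli.symm]
  have e2 : rematch i k π k = i := by
    simp [rematch, ← hl_def, hπl, Equiv.swap_apply_of_ne_of_ne hik hli.symm]
  have e3 : rematch i k π l = m := by
    simp [rematch, ← hl_def, ← hm_def, Equiv.swap_apply_of_ne_of_ne hmk hml]
  have e4 : rematch i k π m = l := by
    simp [rematch, ← hl_def, hπm, Equiv.swap_apply_of_ne_of_ne hmk hml]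
  have hsub : ({i, k, l, m} : Finset V) ⊆ s := by
    intro v hv
    simp only [mem_insert, mem_singleton] at hv
    rcases hv with rfl | rfl | rfl | rfl
    exacts [hi, hk, matchings_apply_mem h hi, matchings_apply_mem h hk]
  have key : ∑ p ∈ s, (g p (rematch i k π p) - g p (π p))
      = ∑ p ∈ ({i, k, l, m} : Finset V), (g p (rematch i k π p) - g p (π p)) := by
    refine (sum_subset hsub fun p _ hp => ?_).symm
    simp only [mem_insert, mem_singleton, not_or] at hp
    obtain ⟨h1, h2, h3, h4⟩ := hp
    have h5 : π p ≠ k := fun h' => h4 (by rw [hm_def, ← h', hinv])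
    have h6 : π p ≠ l := fun h' => h1 (π.injective h')
    simp [rematch, ← hl_def, Equiv.swap_apply_of_ne_of_ne h2 h3, Equiv.swap_apply_of_ne_of_ne h5 h6]
  rw [sum_insert (by simp [hik, hli.symm, hmi.symm]), sum_insert (by simp [hl.symm, hmk.symm]),
    sum_insert (by simp [hml.symm]), sum_singleton, e1, e2, e3, e4, hπl, hπm, ← hl_def,
    ← hm_def, sum_sub_distrib] at key
  linarith

/-- A symmetric array with zero diagonal, whose rows indexed by `s` sum to zero over `s`. -/
structure IsCentered (a : V → V → ℝ) (s : Finset V) : Prop where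
  symm : ∀ i j, a i j = a j i
  diag : ∀ i, a i i = 0
  row : ∀ i ∈ s, ∑ j ∈ s, a i j = 0

/-- The statistic `∑ i, a i (π i)`. -/
def matchSum (a : V → V → ℝ) (s : Finset V) (π : Equiv.Perm V) : ℝ := ∑ i ∈ s, a i (π i)

/-- The change of `matchSum` under rematching `i` with `k`. -/
def matchIncr (a : V → V → ℝ) (i k : V) (π : Equiv.Perm V) : ℝ :=
  2 * (a i k + a (π i) (π k) - a i (π i) - a k (π k))

lemma matchSum_rematch {a : V → V → ℝ} (ha : ∀ i j, a i j = a j i) {s : Finset V}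
    {π : Equiv.Perm V} (h : π ∈ matchings s) {i k : V} (hi : i ∈ s) (hk : k ∈ s) (hik : i ≠ k) :
    matchSum a s (rematch i k π) = matchSum a s π + matchIncr a i k π := by
  rw [matchSum, sum_rematch_apply h hi hk hik, matchSum, matchIncr, ha k i, ha (π i) i,
    ha (π k) k, ha (π k) (π i)]
  ring

/-- The Stein identity for matching statistics. -/
lemma stein_identity {a : V → V → ℝ} {s : Finset V} (ha : IsCentered a s) (f : ℝ → ℝ) :
    ((#s : ℝ) - 1) * avg s (fun π => matchSum a s π * f (matchSum a s π))
      = avg s fun π => ∑ i ∈ s, ∑ k ∈ s,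
          a i k * (f (matchSum a s π + matchIncr a i k π) - f (matchSum a s π)) := by
  have h1 : avg s (fun π => matchSum a s π * f (matchSum a s π))
      = avg s fun π => ∑ i ∈ s, (fun i k π => a i k * f (matchSum a s π)) i (π i) π :=
    avg_congr fun π _ => by simp only [← sum_mul]; rfl
  rw [h1, avg_sum_partner s fun i k π => a i k * f (matchSum a s π), avg_sum]
  refine sum_congr rfl fun i hi => ?_
  have h2 : ∀ π, ∑ k ∈ s, a i k * f (matchSum a s π) = 0 := fun π => by
    rw [← sum_mul, ha.row i hi, zero_mul]
  have h3 : ∀ k ∈ s.erase i, avg s (fun π => a i k * f (matchSum a s (rematch i k π)))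
      = avg s (fun π => a i k * f (matchSum a s π + matchIncr a i k π)) := fun k hk =>
    avg_congr fun π hπ => by
      rw [matchSum_rematch ha.symm hπ hi (mem_of_mem_erase hk) (ne_of_mem_erase hk).symm]
  rw [sum_congr rfl h3, sum_erase s (by simp [ha.diag, avg]), ← avg_sum]
  exact avg_congr fun π _ => by simp only [mul_sub, sum_sub_distrib, h2, sub_zero]

lemma avg_matchSum {a : V → V → ℝ} {s : Finset V} (ha : IsCentered a s) (hs : 2 ≤ #s) :
    avg s (matchSum a s) = 0 := by
  have h := stein_identity ha fun _ => 1
  have h' : (2 : ℝ) ≤ #s := by exact_mod_cast hs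
  simp only [mul_one, sub_self, mul_zero, sum_const_zero] at h
  have h0 : avg s (fun _ => 0) = 0 := by simp [avg]
  rw [h0] at h
  exact (mul_eq_zero.1 h).resolve_left (by linarith)

/-- The sum of the squares of the entries. -/
def sumSq (a : V → V → ℝ) (s : Finset V) : ℝ := ∑ i ∈ s, ∑ j ∈ s, a i j ^ 2

/-- The correlation of the array with its rearrangement by `π`. -/
def pairSum (a : V → V → ℝ) (s : Finset V) (π : Equiv.Perm V) : ℝ :=
  ∑ i ∈ s, ∑ j ∈ s, a i j * a (π i) (π j)

lemma sumSq_nonneg (a : V → V → ℝ) (s : Finset V) : 0 ≤ sumSq a s :=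
  sum_nonneg fun _ _ => sum_nonneg fun _ _ => sq_nonneg _

lemma sum_mul_matchIncr {a : V → V → ℝ} {s : Finset V} (ha : IsCentered a s) (π : Equiv.Perm V) :
    ∑ i ∈ s, ∑ k ∈ s, a i k * matchIncr a i k π = 2 * (sumSq a s + pairSum a s π) := by
  have h1 : ∑ i ∈ s, ∑ k ∈ s, a i k * a i (π i) = 0 := sum_eq_zero fun i hi => by
    rw [← sum_mul, ha.row i hi, zero_mul]
  have h2 : ∑ i ∈ s, ∑ k ∈ s, a i k * a k (π k) = 0 := by
    rw [sum_comm]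
    refine sum_eq_zero fun i hi => ?_
    simp_rw [fun k => ha.symm k i]
    rw [← sum_mul, ha.row i hi, zero_mul]
  have h3 : ∀ i k, a i k * matchIncr a i k π = 2 * a i k ^ 2 + 2 * (a i k * a (π i) (π k))
      - 2 * (a i k * a i (π i)) - 2 * (a i k * a k (π k)) := fun i k => by
    unfold matchIncr; ring
  simp only [h3, sum_sub_distrib, sum_add_distrib, ← mul_sum, h1, h2, sumSq, pairSum]
  ring

lemma avg_matchSum_sq {a : V → V → ℝ} {s : Finset V} (ha : IsCentered a s) (hs : Even #s) :
    ((#s : ℝ) - 1) * avg s (fun π => matchSum a s π ^ 2)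
      = 2 * (sumSq a s + avg s (pairSum a s)) := by
  have h := stein_identity ha fun w => w
  simp only [add_sub_cancel_left, sum_mul_matchIncr ha, avg_const_mul, avg_add, avg_const hs] at h
  simpa only [sq] using h

lemma sum_comp_matching₂ {s : Finset V} {π : Equiv.Perm V} (h : π ∈ matchings s)
    (g : V → V → ℝ) : ∑ i ∈ s, ∑ j ∈ s, g (π i) (π j) = ∑ i ∈ s, ∑ j ∈ s, g i j := by
  rw [← sum_comp_matching h fun i => ∑ j ∈ s, g i j]
  exact sum_congr rfl fun i _ => sum_comp_matching h (g (π i))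

lemma sumSq_add_pairSum (a : V → V → ℝ) {s : Finset V} {π : Equiv.Perm V} (h : π ∈ matchings s) :
    sumSq a s + pairSum a s π = 1 / 2 * ∑ i ∈ s, ∑ j ∈ s, (a i j + a (π i) (π j)) ^ 2 := by
  have := sum_comp_matching₂ h fun i j => a i j ^ 2
  simp only [add_sq, sum_add_distrib, this, mul_assoc, ← mul_sum, sumSq, pairSum]
  ring

lemma sumSq_sub_pairSum (a : V → V → ℝ) {s : Finset V} {π : Equiv.Perm V} (h : π ∈ matchings s) :
    sumSq a s - pairSum a s π = 1 / 2 * ∑ i ∈ s, ∑ j ∈ s, (a i j - a (π i) (π j)) ^ 2 := by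
  have := sum_comp_matching₂ h fun i j => a i j ^ 2
  simp only [sub_sq, sum_add_distrib, sum_sub_distrib, this, mul_assoc, ← mul_sum, sumSq, pairSum]
  ring

lemma abs_pairSum_le (a : V → V → ℝ) {s : Finset V} {π : Equiv.Perm V} (h : π ∈ matchings s) :
    |pairSum a s π| ≤ sumSq a s := by
  have h1 := sumSq_add_pairSum a h
  have h2 := sumSq_sub_pairSum a h
  have h3 : 0 ≤ ∑ i ∈ s, ∑ j ∈ s, (a i j + a (π i) (π j)) ^ 2 :=
    sum_nonneg fun _ _ => sum_nonneg fun _ _ => sq_nonneg _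
  have h4 : 0 ≤ ∑ i ∈ s, ∑ j ∈ s, (a i j - a (π i) (π j)) ^ 2 :=
    sum_nonneg fun _ _ => sum_nonneg fun _ _ => sq_nonneg _
  exact abs_le.2 ⟨by linarith, by linarith⟩

lemma card_erase_erase {s : Finset V} {i k : V} (hi : i ∈ s) (hk : k ∈ s) (hik : i ≠ k) :
    #((s.erase i).erase k) = #s - 2 := by
  rw [card_erase_of_mem (mem_erase.2 ⟨hik.symm, hk⟩), card_erase_of_mem hi]; omega

/-- A nonzero centered array has positive variance. -/
lemma avg_matchSum_sq_pos {a : V → V → ℝ} {s : Finset V} (ha : IsCentered a s) (hs : Even #s)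
    {i k : V} (hi : i ∈ s) (hk : k ∈ s) (hik : a i k ≠ 0) :
    0 < avg s fun π => matchSum a s π ^ 2 := by
  have hne : i ≠ k := fun h => hik (h ▸ ha.diag i)
  have hcard : 2 ≤ #s := by
    simpa [card_pair hne] using card_le_card (show {i, k} ⊆ s by
      intro v; simp only [mem_insert, mem_singleton]; rintro (rfl | rfl) <;> assumption)
  have hcard' : (2 : ℝ) ≤ #s := by exact_mod_cast hcard
  have hs' : Even #((s.erase i).erase k) := by
    rw [card_erase_erase hi hk hne]
    obtain ⟨m, hm⟩ := hs
    exact ⟨m - 1, by omega⟩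
  obtain ⟨ρ, hρ⟩ := matchings_nonempty hs'
  have hπ := mul_swap_mem_matchings hi hk hne hρ
  set π := ρ * Equiv.swap i k
  have hπi : π i = k := by simpa [π] using ((mem_matchings.1 hρ).2 k).2 (by simp)
  have hπk : π k = i := by rw [← hπi]; exact matchings_apply_apply hπ i
  have hpos : 0 < sumSq a s + pairSum a s π := by
    rw [sumSq_add_pairSum a hπ]
    refine mul_pos (by norm_num) (sum_pos' (fun _ _ => sum_nonneg fun _ _ => sq_nonneg _)
      ⟨i, hi, sum_pos' (fun _ _ => sq_nonneg _) ⟨k, hk, ?_⟩⟩)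
    rw [hπi, hπk, ha.symm k i, ← two_mul]
    exact sq_pos_of_ne_zero (mul_ne_zero two_ne_zero hik)
  have havg : 0 < avg s fun π => sumSq a s + pairSum a s π := by
    refine div_pos (sum_pos' (fun σ hσ => ?_) ⟨π, hπ, hpos⟩)
      (Nat.cast_pos.2 (card_pos.2 ⟨π, hπ⟩))
    have := neg_abs_le (pairSum a s σ)
    have := abs_pairSum_le a hσ
    linarith
  rw [avg_add, avg_const hs] at havg
  have := avg_matchSum_sq ha hs
  have h4 : 0 < ((#s : ℝ) - 1) * avg s (fun π => matchSum a s π ^ 2) := by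
    rw [this]; positivity
  exact (mul_pos_iff_of_pos_left (by linarith)).1 h4

lemma avg_sum_apply_le {s : Finset V} (hs : Even #s) {φ : V → V → ℝ} (hφ : ∀ i, 0 ≤ φ i i) :
    ((#s : ℝ) - 1) * avg s (fun π => ∑ i ∈ s, φ i (π i)) ≤ ∑ i ∈ s, ∑ k ∈ s, φ i k := by
  rw [avg_sum_apply s hs]
  refine sum_le_sum fun i hi => ?_
  rw [← add_sum_erase s _ hi]
  linarith [hφ i]

/-- The Euclidean norm of a row. -/
noncomputable def rowNorm (a : V → V → ℝ) (s : Finset V) (i : V) : ℝ := √(∑ j ∈ s, a i j ^ 2)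

lemma rowNorm_nonneg (a : V → V → ℝ) (s : Finset V) (i : V) : 0 ≤ rowNorm a s i :=
  Real.sqrt_nonneg _

lemma rowNorm_sq (a : V → V → ℝ) (s : Finset V) (i : V) :
    rowNorm a s i ^ 2 = ∑ j ∈ s, a i j ^ 2 :=
  Real.sq_sqrt (sum_nonneg fun _ _ => sq_nonneg _)

lemma sum_rowNorm_sq (a : V → V → ℝ) (s : Finset V) :
    ∑ i ∈ s, rowNorm a s i ^ 2 = sumSq a s := by
  simp only [rowNorm_sq, sumSq]

lemma sq_sum_rowNorm_le (a : V → V → ℝ) (s : Finset V) :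
    (∑ i ∈ s, rowNorm a s i) ^ 2 ≤ #s * sumSq a s := by
  rw [← sum_rowNorm_sq]
  exact sq_sum_le_card_mul_sum_sq

/-- The correlation of row `i` with row `k` permuted by `π`. -/
def rowCorr (a : V → V → ℝ) (s : Finset V) (i k : V) (π : Equiv.Perm V) : ℝ :=
  ∑ j ∈ s, a i j * a k (π j)

lemma abs_rowCorr_le (a : V → V → ℝ) {s : Finset V} {π : Equiv.Perm V} (h : π ∈ matchings s)
    (i k : V) : |rowCorr a s i k π| ≤ rowNorm a s i * rowNorm a s k := by
  refine abs_le_of_sq_le_sq ?_ (mul_nonneg (rowNorm_nonneg _ _ _) (rowNorm_nonneg _ _ _))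
  rw [mul_pow, rowNorm_sq, rowNorm_sq, ← sum_comp_matching h fun j => a k j ^ 2]
  exact sum_mul_sq_le_sq_mul_sq _ _ _

lemma abs_sub_rowCorr_rematch_le {a : V → V → ℝ} {s : Finset V} (ha : IsCentered a s)
    {π : Equiv.Perm V} (h : π ∈ matchings s) {i k : V} (hi : i ∈ s) (hk : k ∈ s) (hik : i ≠ k) :
    |rowCorr a s i k (rematch i k π) - rowCorr a s i k π| ≤
      2 * a i k ^ 2 + a k (π k) ^ 2 + a i (π i) ^ 2 + a i (π k) ^ 2 / 2 + a k (π i) ^ 2 / 2 := by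
  have h1 : rowCorr a s i k (rematch i k π) - rowCorr a s i k π
      = a i k * (a i k - a k (π k)) + a i (π i) * (a k (π k) - a i k) + a i (π k) * a k (π i) := by
    rw [rowCorr, sum_rematch_apply h hi hk hik fun j x => a i j * a k x, rowCorr, ha.diag i,
      ha.diag k, ha.symm k i]
    ring
  rw [h1]
  generalize a i k = x; generalize a k (π k) = y; generalize a i (π i) = z
  generalize a i (π k) = u; generalize a k (π i) = v
  rw [abs_le]
  constructor
  · nlinarith [sq_nonneg (x - y), sq_nonneg (z + y), sq_nonneg (z - x), sq_nonneg (u + v)]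
  · nlinarith [sq_nonneg (x + y), sq_nonneg (z - y), sq_nonneg (z + x), sq_nonneg (u - v)]

lemma abs_sub_pairSum_rematch_le {a : V → V → ℝ} {s : Finset V} (ha : ∀ i j, a i j = a j i)
    {π : Equiv.Perm V} (h : π ∈ matchings s) {i k : V} (hi : i ∈ s) (hk : k ∈ s) (hik : i ≠ k) :
    |pairSum a s (rematch i k π) - pairSum a s π| ≤
      4 * (rowNorm a s i * rowNorm a s k + rowNorm a s (π i) * rowNorm a s (π k)
        + rowNorm a s i * rowNorm a s (π i) + rowNorm a s k * rowNorm a s (π k)) := by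
  have key : ∀ σ ∈ matchings s,
      |∑ q ∈ s, (∑ p ∈ s, a p q * a (rematch i k π p) (σ q) - ∑ p ∈ s, a p q * a (π p) (σ q))| ≤
        2 * (rowNorm a s i * rowNorm a s k + rowNorm a s (π i) * rowNorm a s (π k)
          + rowNorm a s i * rowNorm a s (π i) + rowNorm a s k * rowNorm a s (π k)) := by
    intro σ hσ
    have h1 : ∑ q ∈ s, (∑ p ∈ s, a p q * a (rematch i k π p) (σ q)
          - ∑ p ∈ s, a p q * a (π p) (σ q))
        = (rowCorr a s i k σ - rowCorr a s i (π i) σ) + (rowCorr a s k i σ - rowCorr a s k (π k) σ)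
          + (rowCorr a s (π i) (π k) σ - rowCorr a s (π i) i σ)
          + (rowCorr a s (π k) (π i) σ - rowCorr a s (π k) k σ) := by
      simp only [rowCorr, ← sum_sub_distrib, ← sum_add_distrib]
      refine sum_congr rfl fun q _ => ?_
      rw [sum_sub_distrib, sum_rematch_apply h hi hk hik fun p x => a p q * a x (σ q)]
      ring
    rw [h1]
    have e1 := abs_le.1 (abs_rowCorr_le a hσ i k)
    have e2 := abs_le.1 (abs_rowCorr_le a hσ i (π i))
    have e3 := abs_le.1 (abs_rowCorr_le a hσ k i)
    have e4 := abs_le.1 (abs_rowCorr_le a hσ k (π k))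
    have e5 := abs_le.1 (abs_rowCorr_le a hσ (π i) (π k))
    have e6 := abs_le.1 (abs_rowCorr_le a hσ (π i) i)
    have e7 := abs_le.1 (abs_rowCorr_le a hσ (π k) (π i))
    have e8 := abs_le.1 (abs_rowCorr_le a hσ (π k) k)
    exact abs_le.2 ⟨by linarith, by linarith⟩
  have h2 : pairSum a s (rematch i k π) - pairSum a s π
      = ∑ q ∈ s, (∑ p ∈ s, a p q * a (rematch i k π p) (rematch i k π q)
          - ∑ p ∈ s, a p q * a (π p) (rematch i k π q))
        + ∑ q ∈ s, (∑ p ∈ s, a p q * a (rematch i k π p) (π q)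
          - ∑ p ∈ s, a p q * a (π p) (π q)) := by
    have h3 : ∑ q ∈ s, ∑ p ∈ s, a p q * a (rematch i k π p) (π q)
        = ∑ q ∈ s, ∑ p ∈ s, a p q * a (π p) (rematch i k π q) := by
      rw [sum_comm]
      refine sum_congr rfl fun q _ => sum_congr rfl fun p _ => ?_
      rw [ha q p, ha (rematch i k π q)]
    simp only [sum_sub_distrib, h3, pairSum]
    rw [sum_comm, sum_comm (f := fun p q => a p q * a (π p) (π q))]
    ring
  rw [h2]
  have k1 := abs_le.1 (key _ (rematch_mem_matchings h hi hk))
  have k2 := abs_le.1 (key _ h)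
  exact abs_le.2 ⟨by linarith, by linarith⟩

lemma sum_mul_rowNorm_le {a : V → V → ℝ} {s : Finset V} {π : Equiv.Perm V}
    (h : π ∈ matchings s) : ∑ i ∈ s, rowNorm a s i * rowNorm a s (π i) ≤ sumSq a s := by
  have h1 := sum_comp_matching h fun i => rowNorm a s i ^ 2
  have h2 : ∑ i ∈ s, rowNorm a s i * rowNorm a s (π i)
      ≤ ∑ i ∈ s, (rowNorm a s i ^ 2 + rowNorm a s (π i) ^ 2) / 2 :=
    sum_le_sum fun i _ => by linarith [two_mul_le_add_sq (rowNorm a s i) (rowNorm a s (π i))]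
  rw [← sum_div, sum_add_distrib, h1, sum_rowNorm_sq] at h2
  linarith

lemma avg_pairSum_sq_le {a : V → V → ℝ} {s : Finset V} (ha : IsCentered a s) (hs : Even #s)
    (hN : 10 ≤ #s) :
    ((#s : ℝ) - 1) * avg s (fun π => pairSum a s π ^ 2) ≤ 24 * sumSq a s ^ 2 := by
  have hN' : (10 : ℝ) ≤ #s := by exact_mod_cast hN
  set A := sumSq a s with hA
  set ρ := rowNorm a s with hρ
  have hA0 : 0 ≤ A := sumSq_nonneg a s
  have hρ0 : ∀ i, 0 ≤ ρ i := rowNorm_nonneg a s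
  set Bd : V → V → Equiv.Perm V → ℝ := fun i k π =>
    4 * (ρ i ^ 2 * ρ k ^ 2 + (ρ i * ρ (π i)) * (ρ k * ρ (π k)) + (ρ i ^ 2 * ρ (π i)) * ρ k
        + ρ i * (ρ k ^ 2 * ρ (π k)))
      + A * (2 * a i k ^ 2 + a k (π k) ^ 2 + a i (π i) ^ 2 + a i (π k) ^ 2 / 2
        + a k (π i) ^ 2 / 2) with hBd
  have hBd0 : ∀ i k π, 0 ≤ Bd i k π := fun i k π => by
    have := hρ0 i; have := hρ0 k; have := hρ0 (π i); have := hρ0 (π k)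
    simp only [hBd]; positivity
  have h1 : avg s (fun π => pairSum a s π ^ 2)
      = avg s fun π => ∑ i ∈ s, (fun i k π => pairSum a s π * rowCorr a s i k π) i (π i) π :=
    avg_congr fun π _ => by simp only [← mul_sum, sq]; rfl
  have h2 : ∀ i ∈ s, ∀ k ∈ s.erase i,
      avg s (fun π => pairSum a s (rematch i k π) * rowCorr a s i k (rematch i k π))
        ≤ avg s (fun π => pairSum a s π * rowCorr a s i k π + Bd i k π) := by
    intro i hi k hk
    obtain ⟨hki, hk⟩ := mem_erase.1 hk
    refine avg_mono fun π hπ => ?_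
    have e1 := abs_sub_rowCorr_rematch_le ha hπ hi hk hki.symm
    have e2 := abs_sub_pairSum_rematch_le ha.symm hπ hi hk hki.symm
    have e3 := abs_rowCorr_le a (rematch_mem_matchings hπ hi hk) i k
    have e4 := abs_pairSum_le a hπ
    have e5 : pairSum a s (rematch i k π) * rowCorr a s i k (rematch i k π)
        - pairSum a s π * rowCorr a s i k π
        ≤ |pairSum a s (rematch i k π) - pairSum a s π| * |rowCorr a s i k (rematch i k π)|
          + |pairSum a s π| * |rowCorr a s i k (rematch i k π) - rowCorr a s i k π| := by
      rw [← abs_mul, ← abs_mul]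
      refine le_trans (le_of_eq ?_) (add_le_add (le_abs_self _) (le_abs_self _))
      ring
    have e6 := mul_le_mul e2 e3 (abs_nonneg _) (by
      have := hρ0 i; have := hρ0 k; have := hρ0 (π i); have := hρ0 (π k)
      positivity)
    have e7 := mul_le_mul e4 e1 (abs_nonneg _) hA0
    simp only [hBd]
    rw [← hρ] at e6
    rw [← hA] at e7
    nlinarith
  have h3 : ((#s : ℝ) - 1) * avg s (fun π => pairSum a s π ^ 2)
      ≤ ∑ i ∈ s, ∑ k ∈ s.erase i,
        avg s (fun π => pairSum a s π * rowCorr a s i k π + Bd i k π) := by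
    rw [h1, avg_sum_partner s fun i k π => pairSum a s π * rowCorr a s i k π]
    exact sum_le_sum fun i hi => sum_le_sum fun k hk => h2 i hi k hk
  have h4 : ∑ i ∈ s, ∑ k ∈ s.erase i, avg s (fun π => pairSum a s π * rowCorr a s i k π + Bd i k π)
      ≤ avg s fun π => A * A + ∑ i ∈ s, ∑ k ∈ s, Bd i k π := by
    simp_rw [← avg_sum]
    refine avg_mono fun π hπ => ?_
    have e1 : ∀ i ∈ s, ∑ k ∈ s, pairSum a s π * rowCorr a s i k π = 0 := fun i _ => by
      rw [← mul_sum]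
      simp only [rowCorr]
      rw [sum_comm, sum_eq_zero, mul_zero]
      intro j hj
      simp_rw [fun k => ha.symm k (π j)]
      rw [← mul_sum, ha.row _ (matchings_apply_mem hπ hj), mul_zero]
    have e2 : ∀ i ∈ s, ∑ k ∈ s.erase i, (pairSum a s π * rowCorr a s i k π + Bd i k π)
        ≤ A * ρ i ^ 2 + ∑ k ∈ s, Bd i k π := fun i hi => by
      have e3 := add_sum_erase s (fun k => pairSum a s π * rowCorr a s i k π + Bd i k π) hi
      rw [sum_add_distrib (s := s), e1 i hi] at e3
      have e4 := mul_le_mul (abs_pairSum_le a hπ) (abs_rowCorr_le a hπ i i) (abs_nonneg _) hA0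
      rw [← abs_mul] at e4
      have e5 := neg_abs_le (pairSum a s π * rowCorr a s i i π)
      rw [sq, ← hρ, ← hA] at *
      linarith [hBd0 i i π]
    refine (sum_le_sum e2).trans (le_of_eq ?_)
    rw [sum_add_distrib, ← mul_sum, hρ, sum_rowNorm_sq]
  have h5 : avg s (fun π => A * A + ∑ i ∈ s, ∑ k ∈ s, Bd i k π)
      ≤ avg s fun π => 12 * A ^ 2 + 8 * ((∑ k ∈ s, ρ k) * ∑ i ∈ s, ρ i ^ 2 * ρ (π i))
          + 2 * (A * #s) * ∑ i ∈ s, a i (π i) ^ 2 := by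
    refine avg_mono fun π hπ => ?_
    have f1 : ∑ i ∈ s, ρ i ^ 2 = A := sum_rowNorm_sq a s
    have f2 : ∑ i ∈ s, ∑ k ∈ s, a i (π k) ^ 2 = A :=
      sum_congr rfl fun i _ => sum_comp_matching hπ fun k => a i k ^ 2
    have f3 : ∑ i ∈ s, ∑ k ∈ s, a k (π i) ^ 2 = A := by rw [sum_comm]; exact f2
    have f4 : ∑ i ∈ s, ∑ k ∈ s, a i k ^ 2 = A := rfl
    have f5 := sum_mul_rowNorm_le (a := a) hπ
    have f6 : 0 ≤ ∑ i ∈ s, ρ i * ρ (π i) := sum_nonneg fun i _ => mul_nonneg (hρ0 _) (hρ0 _)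
    have f7 : (∑ i ∈ s, ρ i * ρ (π i)) * (∑ i ∈ s, ρ i * ρ (π i)) ≤ A * A :=
      mul_le_mul f5 f5 f6 hA0
    simp only [hBd, sum_add_distrib, ← mul_sum, ← sum_div, f2, f3, f4, ← sum_mul, f1, sum_const,
      nsmul_eq_mul]
    nlinarith
  have h6 : avg s (fun π => 12 * A ^ 2 + 8 * ((∑ k ∈ s, ρ k) * ∑ i ∈ s, ρ i ^ 2 * ρ (π i))
          + 2 * (A * #s) * ∑ i ∈ s, a i (π i) ^ 2)
      = 12 * A ^ 2 + 8 * ((∑ k ∈ s, ρ k) * avg s (fun π => ∑ i ∈ s, ρ i ^ 2 * ρ (π i)))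
          + 2 * (A * #s) * avg s (fun π => ∑ i ∈ s, a i (π i) ^ 2) := by
    simp only [avg_add, avg_const_mul, avg_const hs]
  have h7 := avg_sum_apply_le hs (φ := fun i k => ρ i ^ 2 * ρ k)
    fun i => mul_nonneg (sq_nonneg _) (hρ0 i)
  have h8 := avg_sum_apply_le hs (φ := fun i k => a i k ^ 2) fun i => sq_nonneg _
  simp only [← mul_sum, ← sum_mul] at h7
  rw [show ∑ i ∈ s, ρ i ^ 2 = A from sum_rowNorm_sq a s] at h7
  rw [show ∑ i ∈ s, ∑ k ∈ s, a i k ^ 2 = A from rfl] at h8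
  have h9 : (∑ i ∈ s, ρ i) ^ 2 ≤ #s * A := sq_sum_rowNorm_le a s
  have h10 : 0 ≤ ∑ i ∈ s, ρ i := sum_nonneg fun i _ => hρ0 i
  set X := avg s (fun π => ∑ i ∈ s, ρ i ^ 2 * ρ (π i))
  set Z := avg s (fun π => ∑ i ∈ s, a i (π i) ^ 2)
  set R := ∑ i ∈ s, ρ i
  have h11 : ((#s : ℝ) - 1) * (R * X) ≤ #s * A ^ 2 := by
    nlinarith [mul_le_mul_of_nonneg_left h7 h10, mul_le_mul_of_nonneg_left h9 hA0]
  have h12 : R * X ≤ 10 / 9 * A ^ 2 := by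
    by_contra! hc
    nlinarith [sq_nonneg A]
  have h13 : #s * Z ≤ 10 / 9 * A := by
    have : 0 ≤ Z := avg_nonneg fun π _ => sum_nonneg fun _ _ => sq_nonneg _
    nlinarith
  have h14 : A * (#s * Z) ≤ A * (10 / 9 * A) := mul_le_mul_of_nonneg_left h13 hA0
  refine (h3.trans (h4.trans (h5.trans_eq h6))).trans ?_
  linarith [sq_nonneg A]

/-- The sum of the cubes of the absolute values of the entries. -/
def sumCube (a : V → V → ℝ) (s : Finset V) : ℝ := ∑ i ∈ s, ∑ j ∈ s, |a i j| ^ 3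

lemma sumCube_nonneg (a : V → V → ℝ) (s : Finset V) : 0 ≤ sumCube a s :=
  sum_nonneg fun _ _ => sum_nonneg fun _ _ => pow_nonneg (abs_nonneg _) 3

/-- Four times the squared sum of the absolute values of the entries involved in rematching `i`
with `k`, weighted by `|a i k|`. -/
def incrWeight (a : V → V → ℝ) (i k : V) (π : Equiv.Perm V) : ℝ :=
  |a i k| * (4 * (|a i k| + |a (π i) (π k)| + |a i (π i)| + |a k (π k)|) ^ 2)

lemma abs_matchIncr_le (a : V → V → ℝ) (i k : V) (π : Equiv.Perm V) :
    |matchIncr a i k π| ≤ 2 * (|a i k| + |a (π i) (π k)| + |a i (π i)| + |a k (π k)|) := by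
  rw [matchIncr, abs_mul, abs_two]
  gcongr
  exact (abs_sub _ _).trans (add_le_add_left ((abs_sub _ _).trans
    (add_le_add_left (abs_add_le _ _) _)) _)

lemma abs_mul_matchIncr_sq_le (a : V → V → ℝ) (i k : V) (π : Equiv.Perm V) :
    |a i k| * |matchIncr a i k π| ^ 2 ≤ incrWeight a i k π := by
  unfold incrWeight
  gcongr
  calc |matchIncr a i k π| ^ 2
      ≤ (2 * (|a i k| + |a (π i) (π k)| + |a i (π i)| + |a k (π k)|)) ^ 2 := by
        gcongr; exact abs_matchIncr_le a i k π
    _ = _ := by ring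

lemma mul_sq_le_cubes {x y : ℝ} (hx : 0 ≤ x) (hy : 0 ≤ y) :
    x * y ^ 2 ≤ (x ^ 3 + 2 * y ^ 3) / 3 := by
  nlinarith [mul_nonneg (sq_nonneg (x - y)) (by linarith : 0 ≤ x + 2 * y)]

lemma incrWeight_le (a : V → V → ℝ) (i k : V) (π : Equiv.Perm V) :
    incrWeight a i k π ≤ 32 * |a i k| ^ 3
      + 32 / 3 * (|a (π i) (π k)| ^ 3 + |a i (π i)| ^ 3 + |a k (π k)| ^ 3) := by
  unfold incrWeight
  have hx := abs_nonneg (a i k); have hy := abs_nonneg (a (π i) (π k))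
  have hz := abs_nonneg (a i (π i)); have hw := abs_nonneg (a k (π k))
  generalize |a i k| = x at *; generalize |a (π i) (π k)| = y at *
  generalize |a i (π i)| = z at *; generalize |a k (π k)| = w at *
  have h1 := mul_sq_le_cubes hx hy
  have h2 := mul_sq_le_cubes hx hz
  have h3 := mul_sq_le_cubes hx hw
  have h4 : (x + y + z + w) ^ 2 ≤ 4 * (x ^ 2 + y ^ 2 + z ^ 2 + w ^ 2) := by
    nlinarith [sq_nonneg (x - y), sq_nonneg (x - z), sq_nonneg (x - w), sq_nonneg (y - z),
      sq_nonneg (y - w), sq_nonneg (z - w)]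
  nlinarith [mul_le_mul_of_nonneg_left h4 hx]

lemma avg_incrWeight_le {a : V → V → ℝ} {s : Finset V} (hs : Even #s) (hN : 10 ≤ #s) :
    avg s (fun π => ∑ i ∈ s, ∑ k ∈ s, incrWeight a i k π) ≤ 67 * sumCube a s := by
  have hN' : (10 : ℝ) ≤ #s := by exact_mod_cast hN
  set B := sumCube a s with hB
  have h1 : avg s (fun π => ∑ i ∈ s, ∑ k ∈ s, incrWeight a i k π)
      ≤ avg s fun π => 128 / 3 * B + 64 / 3 * #s * ∑ i ∈ s, |a i (π i)| ^ 3 := by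
    refine avg_mono fun π hπ => ?_
    refine (sum_le_sum fun i _ => sum_le_sum fun k _ => incrWeight_le a i k π).trans ?_
    have h2 := sum_comp_matching₂ hπ fun i j => |a i j| ^ 3
    simp only [sum_add_distrib, ← mul_sum, sum_const, nsmul_eq_mul, h2, hB, sumCube]
    linarith
  rw [avg_add, avg_const hs, avg_const_mul] at h1
  have h3 := avg_sum_apply_le hs (φ := fun i k => |a i k| ^ 3) fun i => by positivity
  rw [show ∑ i ∈ s, ∑ k ∈ s, |a i k| ^ 3 = B from rfl] at h3
  have h4 : 0 ≤ avg s fun π => ∑ i ∈ s, |a i (π i)| ^ 3 :=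
    avg_nonneg fun π _ => sum_nonneg fun _ _ => by positivity
  have h5 : 0 ≤ B := sumCube_nonneg a s
  nlinarith

/-- The distribution function of `matchSum`. -/
noncomputable def matchCDF (a : V → V → ℝ) (s : Finset V) (t : ℝ) : ℝ :=
  avg s fun π => if matchSum a s π ≤ t then 1 else 0

/-- Stein's bound on the distance to the normal distribution function at a point. -/
lemma stein_bound {a : V → V → ℝ} {s : Finset V} (ha : IsCentered a s) (hs : Even #s)
    (hvar : avg s (fun π => matchSum a s π ^ 2) = 1) (t : ℝ) :
    ∃ R : Equiv.Perm V → V → V → ℝ,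
      (∀ π i k, |R π i k| ≤ |matchIncr a i k π| * steinOsc t (matchSum a s π) (matchIncr a i k π)) ∧
      ((#s : ℝ) - 1) * (matchCDF a s t - stdNormalCDF t)
        = 2 * avg s (fun π => (avg s (pairSum a s) - pairSum a s π) * steinDeriv t (matchSum a s π))
          - avg s (fun π => ∑ i ∈ s, ∑ k ∈ s, a i k * R π i k) := by
  refine ⟨fun π i k => steinSol t (matchSum a s π + matchIncr a i k π) - steinSol t (matchSum a s π)
    - matchIncr a i k π * steinDeriv t (matchSum a s π),
    fun π i k => abs_steinSol_taylor_le t _ _, ?_⟩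
  have h1 : matchCDF a s t - stdNormalCDF t = avg s (fun π => steinDeriv t (matchSum a s π))
      - avg s (fun π => matchSum a s π * steinSol t (matchSum a s π)) := by
    rw [matchCDF, ← avg_const hs (stdNormalCDF t), ← avg_sub, ← avg_sub]
    refine avg_congr fun π _ => ?_
    rw [steinDeriv]; ring
  rw [h1, mul_sub, stein_identity ha (steinSol t)]
  have h2 := avg_matchSum_sq ha hs
  rw [hvar, mul_one] at h2
  rw [h2, ← avg_const_mul, ← avg_const_mul, ← avg_sub, ← avg_sub]
  refine avg_congr fun π _ => ?_
  have h3 := sum_mul_matchIncr ha π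
  simp only [mul_sub, sum_sub_distrib, ← mul_assoc, ← sum_mul, h3]
  ring

lemma sumSq_ge {a : V → V → ℝ} {s : Finset V} (ha : IsCentered a s) (hs : Even #s)
    (hvar : avg s (fun π => matchSum a s π ^ 2) = 1) : ((#s : ℝ) - 1) / 4 ≤ sumSq a s := by
  have h2 := avg_matchSum_sq ha hs
  have h3 : avg s (pairSum a s) ≤ avg s fun _ => sumSq a s :=
    avg_mono fun π hπ => (le_abs_self _).trans (abs_pairSum_le a hπ)
  rw [avg_const hs] at h3
  rw [hvar, mul_one] at h2
  linarith

lemma sumSq_pow_three_le (a : V → V → ℝ) (s : Finset V) :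
    sumSq a s ^ 3 ≤ (sumCube a s * #s) ^ 2 := by
  have hA := sumSq_nonneg a s
  have hB := sumCube_nonneg a s
  rcases s.eq_empty_or_nonempty with rfl | hne
  · simp [sumSq]
  have hN : (0 : ℝ) < #s := Nat.cast_pos.2 hne.card_pos
  have key : ∀ τ : ℝ, 0 ≤ τ → 3 * τ * sumSq a s - #s ^ 2 * τ ^ 3 ≤ 2 * sumCube a s := by
    intro τ hτ
    have h : ∀ i j, 3 * τ * a i j ^ 2 - τ ^ 3 ≤ 2 * |a i j| ^ 3 := fun i j => by
      have := mul_sq_le_cubes hτ (abs_nonneg (a i j))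
      rw [sq_abs] at this
      linarith
    have := sum_le_sum fun i (_ : i ∈ s) => sum_le_sum fun j (_ : j ∈ s) => h i j
    simp only [sum_sub_distrib, ← mul_sum, sum_const, nsmul_eq_mul] at this
    simp only [sumSq, sumCube]
    linarith
  have h := key (√(sumSq a s) / #s) (by positivity)
  have hr := Real.sq_sqrt hA
  set r := √(sumSq a s)
  have hr0 : 0 ≤ r := Real.sqrt_nonneg _
  rw [← hr] at h ⊢
  have h2 : 3 * (r / #s) * r ^ 2 - #s ^ 2 * (r / #s) ^ 3 = 2 * (r ^ 3 / #s) := by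
    field_simp; ring
  rw [h2] at h
  have h3 : r ^ 3 ≤ sumCube a s * #s := by
    rw [← div_le_iff₀ hN]; linarith
  calc (r ^ 2) ^ 3 = (r ^ 3) ^ 2 := by ring
    _ ≤ _ := by gcongr

/-- Fluctuations of the conditional variance. -/
lemma avg_pairSum_sub_sq_le {a : V → V → ℝ} {s : Finset V} (ha : IsCentered a s) (hs : Even #s)
    (hN : 10 ≤ #s) (hvar : avg s (fun π => matchSum a s π ^ 2) = 1) :
    avg s (fun π => (avg s (pairSum a s) - pairSum a s π) ^ 2) ≤ (11 * sumCube a s) ^ 2 := by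
  have hN' : (10 : ℝ) ≤ #s := by exact_mod_cast hN
  have h1 := avg_pairSum_sq_le ha hs hN
  have h2 := sumSq_ge ha hs hvar
  have h3 := sumSq_pow_three_le a s
  set m := avg s (pairSum a s) with hm
  have h4 : avg s (fun π => (m - pairSum a s π) ^ 2)
      = avg s (fun π => pairSum a s π ^ 2) - m ^ 2 := by
    have : avg s (fun π => (m - pairSum a s π) ^ 2)
        = avg s (fun π => (m ^ 2 - 2 * m * pairSum a s π) + pairSum a s π ^ 2) :=
      avg_congr fun π _ => by ring
    rw [this, avg_add, avg_sub, avg_const_mul, avg_const hs, ← hm]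
    ring
  rw [h4]
  set X := avg s (fun π => pairSum a s π ^ 2)
  set A := sumSq a s
  set B := sumCube a s
  set N : ℝ := (#s : ℝ)
  have hA0 : 0 < A := by linarith
  have h5 : (A - (N - 1) / 4) * A ^ 2 ≥ 0 := mul_nonneg (by linarith) (sq_nonneg _)
  have h6 : (N - 1) * A ^ 2 ≤ 4 * (B * N) ^ 2 := by nlinarith
  have h7 : (N - 1) ^ 2 * X ≤ 96 * (B * N) ^ 2 := by nlinarith
  have h8 : (81 / 100) * N ^ 2 ≤ (N - 1) ^ 2 := by nlinarith
  have h9 : 0 ≤ X := avg_nonneg fun π _ => sq_nonneg _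
  have h10 : N ^ 2 * (81 / 100 * X) ≤ N ^ 2 * (96 * B ^ 2) := by nlinarith
  have h11 := le_of_mul_le_mul_left h10 (by positivity)
  nlinarith [sq_nonneg m, sq_nonneg B]

lemma avg_mul_le {s : Finset V} {g h : Equiv.Perm V → ℝ} {x y : ℝ}
    (hx : 0 ≤ x) (hy : 0 ≤ y) (hg : avg s (fun π => g π ^ 2) ≤ x ^ 2)
    (hh : avg s (fun π => h π ^ 2) ≤ y ^ 2) : avg s (fun π => g π * h π) ≤ x * y := by
  refine (le_abs_self _).trans (abs_le_of_sq_le_sq ?_ (mul_nonneg hx hy))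
  rw [mul_pow]
  exact (sq_avg_mul_le g h).trans (mul_le_mul hg hh (avg_nonneg fun _ _ => sq_nonneg _)
    (sq_nonneg x))

lemma abs_matchCDF_sub_le {a : V → V → ℝ} {s : Finset V} (ha : IsCentered a s) (hs : Even #s)
    (hN : 10 ≤ #s) (hvar : avg s (fun π => matchSum a s π ^ 2) = 1) (t : ℝ) :
    ((#s : ℝ) - 1) * |matchCDF a s t - stdNormalCDF t|
      ≤ avg s (fun π => 2 * (|avg s (pairSum a s) - pairSum a s π|
            * |steinDeriv t (matchSum a s π)|)
          + ∑ i ∈ s, ∑ k ∈ s, |a i k| * |matchIncr a i k π|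
            * steinOsc t (matchSum a s π) (matchIncr a i k π)) := by
  have hN' : (10 : ℝ) ≤ #s := by exact_mod_cast hN
  obtain ⟨R, hR, h⟩ := stein_bound ha hs hvar t
  rw [← abs_of_nonneg (by linarith : (0 : ℝ) ≤ #s - 1), ← abs_mul, h, ← avg_const_mul, ← avg_sub]
  refine (abs_avg_le _ _).trans (avg_mono fun π _ => (abs_sub _ _).trans (add_le_add ?_ ?_))
  · rw [abs_mul, abs_mul, abs_two]
  · refine (abs_sum_le_sum_abs _ _).trans (sum_le_sum fun i _ =>
      (abs_sum_le_sum_abs _ _).trans (sum_le_sum fun k _ => ?_))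
    rw [abs_mul, mul_assoc]
    exact mul_le_mul_of_nonneg_left (hR π i k) (abs_nonneg _)

lemma integrable_avg {s : Finset V} {μ : Measure ℝ} {h : Equiv.Perm V → ℝ → ℝ}
    (hh : ∀ π ∈ matchings s, Integrable (h π) μ) : Integrable (fun t => avg s fun π => h π t) μ :=
  (integrable_finsetSum _ hh).div_const _

lemma integral_avg {s : Finset V} {μ : Measure ℝ} {h : Equiv.Perm V → ℝ → ℝ}
    (hh : ∀ π ∈ matchings s, Integrable (h π) μ) :
    ∫ t, (avg s fun π => h π t) ∂μ = avg s fun π => ∫ t, h π t ∂μ := by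
  simp only [avg]
  rw [integral_div, integral_finsetSum _ hh]

lemma integrable_matchCDF_sub (a : V → V → ℝ) {s : Finset V} (hs : Even #s) :
    Integrable fun t => matchCDF a s t - stdNormalCDF t := by
  have : (fun t => matchCDF a s t - stdNormalCDF t)
      = fun t => avg s fun π => (if matchSum a s π ≤ t then 1 else 0) - stdNormalCDF t := by
    funext t
    rw [matchCDF, avg_sub, avg_const hs]
  rw [this]
  exact integrable_avg fun π _ => integrable_indicator_sub_stdNormalCDF _

/-- The `L¹` bound for a centered array with unit variance. -/
theorem integral_abs_matchCDF_sub_le {a : V → V → ℝ} {s : Finset V} (ha : IsCentered a s)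
    (hs : Even #s) (hN : 10 ≤ #s) (hvar : avg s (fun π => matchSum a s π ^ 2) = 1) :
    ∫ t, |matchCDF a s t - stdNormalCDF t| ≤ 379 * (sumCube a s / #s) := by
  have hN' : (10 : ℝ) ≤ #s := by exact_mod_cast hN
  set m := avg s (pairSum a s) with hm
  have hB := sumCube_nonneg a s
  have hi1 : ∀ π, Integrable fun t => 2 * (|m - pairSum a s π| * |steinDeriv t (matchSum a s π)|) :=
    fun π => ((integrable_steinDeriv _).abs.const_mul _).const_mul _
  have hi2 : ∀ π i k, Integrable fun t => |a i k| * |matchIncr a i k π|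
            * steinOsc t (matchSum a s π) (matchIncr a i k π) :=
    fun π i k => (integrable_steinOsc _ _).const_mul _
  have hi3 : ∀ π i, Integrable fun t => ∑ k ∈ s, |a i k| * |matchIncr a i k π|
            * steinOsc t (matchSum a s π) (matchIncr a i k π) :=
    fun π i => integrable_finsetSum _ fun k _ => hi2 π i k
  have hi4 : ∀ π, Integrable fun t => ∑ i ∈ s, ∑ k ∈ s, |a i k| * |matchIncr a i k π|
            * steinOsc t (matchSum a s π) (matchIncr a i k π) :=
    fun π => integrable_finsetSum _ fun i _ => hi3 π i
  have h1 : ((#s : ℝ) - 1) * ∫ t, |matchCDF a s t - stdNormalCDF t|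
      ≤ avg s fun π => 2 * (|m - pairSum a s π| * (2 * |matchSum a s π| + 1))
        + 2 * ∑ i ∈ s, ∑ k ∈ s, incrWeight a i k π := by
    rw [← integral_const_mul]
    refine (integral_mono ((integrable_matchCDF_sub a hs).abs.const_mul _)
      (integrable_avg fun π _ => (hi1 π).add (hi4 π))
      (abs_matchCDF_sub_le ha hs hN hvar)).trans ?_
    refine (integral_avg fun π _ => (hi1 π).add (hi4 π)).trans_le (avg_mono fun π _ => ?_)
    simp only [Pi.add_apply]
    rw [integral_add (hi1 π) (hi4 π), integral_const_mul, integral_const_mul,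
      integral_finsetSum _ fun i _ => hi3 π i, mul_sum]
    refine add_le_add ?_ (sum_le_sum fun i _ => ?_)
    · gcongr
      exact integral_abs_steinDeriv_le _
    · rw [integral_finsetSum _ fun k _ => hi2 π i k, mul_sum]
      refine sum_le_sum fun k _ => ?_
      rw [integral_const_mul]
      have e1 := mul_le_mul_of_nonneg_left (integral_steinOsc_le (matchSum a s π)
        (matchIncr a i k π)) (by positivity : 0 ≤ |a i k| * |matchIncr a i k π|)
      have e2 := abs_mul_matchIncr_sq_le a i k π
      nlinarith
  rw [avg_add, avg_const_mul, avg_const_mul] at h1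
  have h2 : avg s (fun π => (2 * |matchSum a s π| + 1) ^ 2) ≤ 3 ^ 2 := by
    have e : avg s (fun π => (2 * |matchSum a s π| + 1) ^ 2)
        ≤ avg s fun π => 6 * matchSum a s π ^ 2 + 3 := by
      refine avg_mono fun π _ => ?_
      nlinarith [sq_abs (matchSum a s π), sq_nonneg (|matchSum a s π| - 1)]
    rw [avg_add, avg_const_mul, hvar, avg_const hs] at e
    linarith
  have h3 : avg s (fun π => |m - pairSum a s π| * (2 * |matchSum a s π| + 1))
      ≤ 11 * sumCube a s * 3 :=
    avg_mul_le (by positivity) (by norm_num)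
      (by simpa only [sq_abs] using avg_pairSum_sub_sq_le ha hs hN hvar) h2
  have h4 := avg_incrWeight_le (a := a) hs hN
  have h5 : ((#s : ℝ) - 1) * ∫ t, |matchCDF a s t - stdNormalCDF t| ≤ 200 * sumCube a s := by
    linarith
  rw [← mul_div_assoc, le_div_iff₀ (by linarith)]
  have h6 : 0 ≤ ∫ t, |matchCDF a s t - stdNormalCDF t| := integral_nonneg fun _ => abs_nonneg _
  nlinarith

/-! ### Recentering an array -/

/-- The row effects subtracted by `recenter`. -/
noncomputable def rowShift (a : V → V → ℝ) (s : Finset V) (i : V) : ℝ :=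
  (∑ j ∈ s, a i j) / ((#s : ℝ) - 2)
    - (∑ p ∈ s, ∑ q ∈ s, a p q) / (2 * (((#s : ℝ) - 1) * ((#s : ℝ) - 2)))

/-- The array with its row and column effects over `s` removed. -/
noncomputable def recenter (a : V → V → ℝ) (s : Finset V) (i j : V) : ℝ :=
  if i = j then 0 else a i j - rowShift a s i - rowShift a s j

lemma sum_rowShift (a : V → V → ℝ) {s : Finset V} (hs : 3 ≤ #s) :
    2 * ∑ i ∈ s, rowShift a s i = (∑ p ∈ s, ∑ q ∈ s, a p q) / ((#s : ℝ) - 1) := by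
  have hs' : (3 : ℝ) ≤ #s := by exact_mod_cast hs
  have h1 : (#s : ℝ) - 1 ≠ 0 := by linarith
  have h2 : (#s : ℝ) - 2 ≠ 0 := by linarith
  simp only [rowShift, sum_sub_distrib, ← sum_div, sum_const, nsmul_eq_mul]
  field_simp
  ring

lemma isCentered_recenter {a : V → V → ℝ} (ha : ∀ i j, a i j = a j i) (hd : ∀ i, a i i = 0)
    {s : Finset V} (hs : 3 ≤ #s) : IsCentered (recenter a s) s where
  symm i j := by simp only [recenter, eq_comm (a := i), ha i j]; split_ifs <;> ring
  diag i := by simp [recenter]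
  row i hi := by
    have hs' : (3 : ℝ) ≤ #s := by exact_mod_cast hs
    have h1 : (#s : ℝ) - 1 ≠ 0 := by linarith
    have h2 : (#s : ℝ) - 2 ≠ 0 := by linarith
    have h3 : ∀ j ∈ s.erase i, recenter a s i j = a i j - rowShift a s i - rowShift a s j :=
      fun j hj => by rw [recenter, if_neg (ne_of_mem_erase hj).symm]
    have h4 := add_sum_erase s (fun j => a i j - rowShift a s i - rowShift a s j) hi
    rw [← add_sum_erase s _ hi, sum_congr rfl h3, recenter, if_pos rfl]
    rw [sum_sub_distrib (s := s), sum_sub_distrib (s := s), sum_const, nsmul_eq_mul, hd] at h4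
    have h5 := sum_rowShift a hs
    have h6 : ((#s : ℝ) - 2) * rowShift a s i
        = (∑ j ∈ s, a i j) - (∑ p ∈ s, ∑ q ∈ s, a p q) / ((#s : ℝ) - 1) / 2 := by
      rw [rowShift]; field_simp
    linarith

lemma matchSum_eq_recenter (a : V → V → ℝ) {s : Finset V} (hs : 3 ≤ #s) {π : Equiv.Perm V}
    (h : π ∈ matchings s) :
    matchSum a s π
      = matchSum (recenter a s) s π + (∑ p ∈ s, ∑ q ∈ s, a p q) / ((#s : ℝ) - 1) := by
  rw [← sum_rowShift a hs, two_mul]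
  nth_rewrite 2 [← sum_comp_matching h]
  rw [matchSum, matchSum, ← sum_add_distrib, ← sum_add_distrib]
  refine sum_congr rfl fun i hi => ?_
  rw [recenter, if_neg (matchings_apply_ne h hi).symm]
  ring

/-! ### Rescaling an array -/

lemma IsCentered.const_mul {a : V → V → ℝ} {s : Finset V} (ha : IsCentered a s) (c : ℝ) :
    IsCentered (fun i j => c * a i j) s where
  symm i j := by rw [ha.symm]
  diag i := by rw [ha.diag, mul_zero]
  row i hi := by rw [← mul_sum, ha.row i hi, mul_zero]

lemma matchSum_const_mul (a : V → V → ℝ) (s : Finset V) (c : ℝ) (π : Equiv.Perm V) :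
    matchSum (fun i j => c * a i j) s π = c * matchSum a s π := by
  rw [matchSum, matchSum, mul_sum]

lemma sumCube_const_mul (a : V → V → ℝ) (s : Finset V) {c : ℝ} (hc : 0 ≤ c) :
    sumCube (fun i j => c * a i j) s = c ^ 3 * sumCube a s := by
  simp only [sumCube, abs_mul, mul_pow, mul_sum, abs_of_nonneg hc]

lemma matchCDF_const_mul (a : V → V → ℝ) (s : Finset V) {c : ℝ} (hc : 0 < c) (t : ℝ) :
    matchCDF (fun i j => c * a i j) s (c * t) = matchCDF a s t :=
  avg_congr fun π _ => by simp only [matchSum_const_mul, mul_le_mul_iff_right₀ hc]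

lemma matchCDF_recenter (a : V → V → ℝ) {s : Finset V} (hs : 3 ≤ #s) (t : ℝ) :
    matchCDF a s t
      = matchCDF (recenter a s) s (t - (∑ p ∈ s, ∑ q ∈ s, a p q) / ((#s : ℝ) - 1)) :=
  avg_congr fun π hπ => by simp only [matchSum_eq_recenter a hs hπ, le_sub_iff_add_le]

lemma avg_normalize_sq {a : V → V → ℝ} {s : Finset V} {v : ℝ} (hv : 0 < v)
    (h : avg s (fun π => matchSum a s π ^ 2) = v) :
    avg s (fun π => matchSum (fun i j => (√v)⁻¹ * a i j) s π ^ 2) = 1 := by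
  simp only [matchSum_const_mul, mul_pow, avg_const_mul, h, inv_pow, Real.sq_sqrt hv.le]
  exact inv_mul_cancel₀ hv.ne'

/-- A normal approximation controls the concentration of `matchSum`. -/
lemma matchCDF_sub_le {a : V → V → ℝ} {s : Finset V} {v ε : ℝ} (hv : 0 < v)
    (h : ∀ t, |matchCDF (fun i j => (√v)⁻¹ * a i j) s t - stdNormalCDF t| ≤ ε) {x y : ℝ}
    (hxy : x ≤ y) :
    matchCDF a s y - matchCDF a s x ≤ 2 / 5 * ((√v)⁻¹ * (y - x)) + 2 * ε := by
  have hc : 0 < (√v)⁻¹ := inv_pos.2 (Real.sqrt_pos.2 hv)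
  have h1 := (abs_le.1 (h ((√v)⁻¹ * y))).2
  have h2 := (abs_le.1 (h ((√v)⁻¹ * x))).1
  have h3 := stdNormalCDF_sub_le (mul_le_mul_of_nonneg_left hxy hc.le)
  rw [matchCDF_const_mul a s hc] at h1 h2
  rw [mul_sub]
  linarith

lemma avg_pairSum_abs_le {a : V → V → ℝ} {s : Finset V} (ha : IsCentered a s) (hs : Even #s)
    (hN : 97 ≤ #s) : |avg s (pairSum a s)| ≤ sumSq a s / 2 := by
  have hN' : (97 : ℝ) ≤ #s := by exact_mod_cast hN
  have h1 := avg_pairSum_sq_le ha hs (by omega)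
  have h2 := sq_avg_le hs (pairSum a s)
  have hA := sumSq_nonneg a s
  refine abs_le_of_sq_le_sq ?_ (by linarith)
  have h3 : 0 ≤ avg s (pairSum a s) ^ 2 := sq_nonneg _
  nlinarith

lemma variance_bounds {a : V → V → ℝ} {s : Finset V} (ha : IsCentered a s) (hs : Even #s)
    (hN : 97 ≤ #s) :
    sumSq a s ≤ ((#s : ℝ) - 1) * avg s (fun π => matchSum a s π ^ 2) ∧
      ((#s : ℝ) - 1) * avg s (fun π => matchSum a s π ^ 2) ≤ 3 * sumSq a s := by
  rw [avg_matchSum_sq ha hs]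
  have := abs_le.1 (avg_pairSum_abs_le ha hs hN)
  constructor <;> linarith

/-! ### Removing two pairs of vertices -/

lemma exists_entry_bound (a : V → V → ℝ) (s : Finset V) :
    ∃ b : ℝ, 0 ≤ b ∧ b ^ 3 ≤ sumCube a s ∧ ∀ i ∈ s, ∀ j ∈ s, |a i j| ≤ b := by
  have hB := sumCube_nonneg a s
  have hb : (sumCube a s ^ (1 / 3 : ℝ)) ^ 3 = sumCube a s := by
    rw [← Real.rpow_natCast, ← Real.rpow_mul hB]; norm_num
  refine ⟨sumCube a s ^ (1 / 3 : ℝ), Real.rpow_nonneg hB _, hb.le, fun i hi j hj => ?_⟩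
  refine le_of_pow_le_pow_left₀ three_ne_zero (Real.rpow_nonneg hB _) ?_
  rw [hb]
  exact (single_le_sum (f := fun j => |a i j| ^ 3) (fun _ _ => by positivity) hj).trans
    (single_le_sum (f := fun i => ∑ j ∈ s, |a i j| ^ 3)
      (fun _ _ => sum_nonneg fun _ _ => by positivity) hi)

lemma abs_sum_le_card_mul {ι : Type*} (t : Finset ι) {f : ι → ℝ} {c : ℝ}
    (h : ∀ x ∈ t, |f x| ≤ c) : |∑ x ∈ t, f x| ≤ #t * c := by
  refine (abs_sum_le_sum_abs _ _).trans ((sum_le_sum h).trans_eq ?_)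
  rw [sum_const, nsmul_eq_mul]

section Restrict

variable {a : V → V → ℝ} {s t : Finset V} {b : ℝ}

lemma abs_row_restrict_le (ha : IsCentered a s) (hts : t ⊆ s) (hcard : #(s \ t) = 4)
    (hb : ∀ i ∈ s, ∀ j ∈ s, |a i j| ≤ b) {p : V} (hp : p ∈ s) :
    |∑ q ∈ t, a p q| ≤ 4 * b := by
  have h1 := sum_sdiff hts (f := a p)
  rw [ha.row p hp] at h1
  have h2 := abs_sum_le_card_mul (s \ t) (f := a p) fun q hq => hb p hp q (sdiff_subset hq)
  rw [hcard] at h2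
  rw [eq_neg_of_add_eq_zero_right h1, abs_neg]
  exact_mod_cast h2

lemma abs_total_restrict_le (ha : IsCentered a s) (hts : t ⊆ s) (hcard : #(s \ t) = 4)
    (hb : ∀ i ∈ s, ∀ j ∈ s, |a i j| ≤ b) :
    |∑ p ∈ t, ∑ q ∈ t, a p q| ≤ 16 * b := by
  have h1 : ∑ p ∈ s, ∑ q ∈ t, a p q = 0 := by
    rw [sum_comm]
    refine sum_eq_zero fun q hq => ?_
    simp_rw [fun p => ha.symm p q]
    exact ha.row q (hts hq)
  have h2 := sum_sdiff hts (f := fun p => ∑ q ∈ t, a p q)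
  have h3 := abs_sum_le_card_mul (s \ t) (f := fun p => ∑ q ∈ t, a p q) fun p hp =>
    abs_row_restrict_le ha hts hcard hb (sdiff_subset hp)
  rw [hcard] at h3
  rw [h1] at h2
  rw [eq_neg_of_add_eq_zero_right h2, abs_neg]
  exact h3.trans_eq (by push_cast; ring)

lemma abs_rowShift_restrict_le (ha : IsCentered a s) (hts : t ⊆ s) (hcard : #(s \ t) = 4)
    (hN : 100 ≤ #s) (hb0 : 0 ≤ b) (hb : ∀ i ∈ s, ∀ j ∈ s, |a i j| ≤ b) {p : V} (hp : p ∈ t) :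
    |rowShift a t p| ≤ 6 * (b / #s) := by
  have hN' : (100 : ℝ) ≤ #s := by exact_mod_cast hN
  have hct : (#t : ℝ) = #s - 4 := by
    have := card_sdiff_add_card_eq_card hts
    rw [hcard] at this
    rw [← this]; push_cast; ring
  have h1 := abs_row_restrict_le ha hts hcard hb (hts hp)
  have h2 := abs_total_restrict_le ha hts hcard hb
  rw [rowShift, hct]
  refine (abs_sub _ _).trans ?_
  rw [abs_div, abs_div, abs_of_pos (by linarith : (0 : ℝ) < #s - 4 - 2),
    abs_of_pos (by nlinarith : (0 : ℝ) < 2 * ((#s - 4 - 1) * (#s - 4 - 2)))]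
  have h3 : |∑ j ∈ t, a p j| / ((#s : ℝ) - 4 - 2) ≤ 5 * (b / #s) := by
    rw [← mul_div_assoc, div_le_div_iff₀ (by linarith) (by linarith)]
    nlinarith
  have h4 : |∑ p ∈ t, ∑ q ∈ t, a p q| / (2 * (((#s : ℝ) - 4 - 1) * (#s - 4 - 2))) ≤ b / #s := by
    rw [div_le_div_iff₀ (by nlinarith) (by linarith)]
    have : 16 * (#s : ℝ) ≤ 2 * ((#s - 4 - 1) * (#s - 4 - 2)) := by nlinarith
    nlinarith
  linarith

lemma abs_sub_recenter_le (hd : ∀ i, a i i = 0) (hb0 : 0 ≤ b)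
    (hc : ∀ p ∈ t, |rowShift a t p| ≤ 6 * (b / #s)) {p q : V} (hp : p ∈ t) (hq : q ∈ t) :
    |a p q - recenter a t p q| ≤ 12 * (b / #s) := by
  rw [recenter]
  split_ifs with h
  · rw [h, hd, sub_zero, abs_zero]; positivity
  · rw [show a p q - (a p q - rowShift a t p - rowShift a t q)
      = rowShift a t p + rowShift a t q by ring]
    linarith [abs_add_le (rowShift a t p) (rowShift a t q), hc p hp, hc q hq]

lemma sumCube_recenter_le (hts : t ⊆ s) (hN : 10000 ≤ #s) (hb0 : 0 ≤ b)
    (hbB : b ^ 3 ≤ sumCube a s)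
    (hd : ∀ p ∈ t, ∀ q ∈ t, |a p q - recenter a t p q| ≤ 12 * (b / #s)) :
    sumCube (recenter a t) t ≤ 5 * sumCube a s := by
  have hN' : (10000 : ℝ) ≤ #s := by exact_mod_cast hN
  have h1 : ∀ p ∈ t, ∀ q ∈ t,
      |recenter a t p q| ^ 3 ≤ 4 * |a p q| ^ 3 + 4 * (12 * (b / #s)) ^ 3 := by
    intro p hp q hq
    have e1 : |recenter a t p q| ≤ |a p q| + 12 * (b / #s) := by
      have := hd p hp q hq
      have := abs_sub_abs_le_abs_sub (recenter a t p q) (a p q)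
      rw [abs_sub_comm] at this
      linarith
    have e2 : 0 ≤ 12 * (b / #s) := by positivity
    refine (pow_le_pow_left₀ (abs_nonneg _) e1 3).trans ?_
    have := abs_nonneg (a p q)
    generalize |a p q| = x at *
    generalize 12 * (b / #s) = y at *
    nlinarith [mul_nonneg (add_nonneg this e2) (sq_nonneg (x - y))]
  have h2 : ∑ p ∈ t, ∑ q ∈ t, |a p q| ^ 3 ≤ sumCube a s := by
    refine (sum_le_sum fun p _ => sum_le_sum_of_subset_of_nonneg hts fun _ _ _ => by
      positivity).trans (sum_le_sum_of_subset_of_nonneg hts fun _ _ _ => sum_nonneg fun _ _ => by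
      positivity)
  have h3 := sum_le_sum fun p hp => sum_le_sum fun q hq => h1 p hp q hq
  simp only [sum_add_distrib, ← mul_sum, sum_const, nsmul_eq_mul] at h3
  have h4 : (#t : ℝ) ≤ #s := by exact_mod_cast card_le_card hts
  have h5 : (#t : ℝ) * (#t * (4 * (12 * (b / #s)) ^ 3))
      ≤ #s * (#s * (4 * (12 * (b / #s)) ^ 3)) := by
    gcongr
  have h6 : (#s : ℝ) * (#s * (4 * (12 * (b / #s)) ^ 3)) = 6912 * (b ^ 3 / #s) := by
    field_simp; ring
  have h7 : b ^ 3 / #s ≤ sumCube a s / 10000 := by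
    gcongr; exact sumCube_nonneg a s
  have h8 := sumCube_nonneg a s
  rw [h6] at h5
  refine h3.trans ?_
  linarith

lemma sumSq_recenter_le (hts : t ⊆ s) (hN : 0 < #s)
    (hd : ∀ p ∈ t, ∀ q ∈ t, |a p q - recenter a t p q| ≤ 12 * (b / #s)) :
    sumSq (recenter a t) t ≤ 2 * sumSq a s + 288 * b ^ 2 ∧
      sumSq a t ≤ 2 * sumSq (recenter a t) t + 288 * b ^ 2 := by
  have hN' : (0 : ℝ) < #s := by exact_mod_cast hN
  have h4 : (#t : ℝ) ≤ #s := by exact_mod_cast card_le_card hts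
  have h5 : (#t : ℝ) * (#t * (2 * (12 * (b / #s)) ^ 2))
      ≤ #s * (#s * (2 * (12 * (b / #s)) ^ 2)) := by
    gcongr
  have h6 : (#s : ℝ) * (#s * (2 * (12 * (b / #s)) ^ 2)) = 288 * b ^ 2 := by
    field_simp; ring
  have h2 : sumSq a t ≤ sumSq a s := by
    refine (sum_le_sum fun p _ => sum_le_sum_of_subset_of_nonneg hts fun _ _ _ => by
      positivity).trans (sum_le_sum_of_subset_of_nonneg hts fun _ _ _ => sum_nonneg fun _ _ => by
      positivity)
  have key : ∀ u v : V → V → ℝ, (∀ p ∈ t, ∀ q ∈ t, |u p q - v p q| ≤ 12 * (b / #s)) →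
      sumSq u t ≤ 2 * sumSq v t + 288 * b ^ 2 := by
    intro u v huv
    have h1 : ∀ p ∈ t, ∀ q ∈ t, u p q ^ 2 ≤ 2 * v p q ^ 2 + 2 * (12 * (b / #s)) ^ 2 := by
      intro p hp q hq
      have e1 : (u p q - v p q) ^ 2 ≤ (12 * (b / #s)) ^ 2 := sq_le_sq' (by
        linarith [(abs_le.1 (huv p hp q hq)).1]) (abs_le.1 (huv p hp q hq)).2
      nlinarith [sq_nonneg (u p q - 2 * v p q)]
    have h3 := sum_le_sum fun p hp => sum_le_sum fun q hq => h1 p hp q hq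
    simp only [sum_add_distrib, ← mul_sum, sum_const, nsmul_eq_mul] at h3
    simp only [sumSq]
    linarith
  refine ⟨(key _ a fun p hp q hq => ?_).trans (by linarith), key _ _ hd⟩
  rw [abs_sub_comm]; exact hd p hp q hq

lemma sumSq_restrict_ge (ha : ∀ i j, a i j = a j i) (hts : t ⊆ s) (hcard : #(s \ t) = 4) :
    sumSq a s - 8 * (#s / 30000 + 67 * sumCube a s) ≤ sumSq a t := by
  have hB := sumCube_nonneg a s
  have h1 : ∀ r ∈ s \ t, ∑ j ∈ s, a r j ^ 2 ≤ #s / 30000 + 67 * sumCube a s := by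
    intro r hr
    have e1 : ∀ j ∈ s, a r j ^ 2 ≤ 1 / 30000 + 67 * |a r j| ^ 3 := fun j _ => by
      have := mul_sq_le_cubes (by norm_num : (0 : ℝ) ≤ 1 / 100) (abs_nonneg (a r j))
      have h3 := pow_nonneg (abs_nonneg (a r j)) 3
      rw [sq_abs] at this
      linarith
    have e2 : ∑ j ∈ s, |a r j| ^ 3 ≤ sumCube a s :=
      single_le_sum (f := fun i => ∑ j ∈ s, |a i j| ^ 3)
        (fun _ _ => sum_nonneg fun _ _ => by positivity) (sdiff_subset hr)
    have e3 := sum_le_sum e1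
    rw [sum_add_distrib, ← mul_sum, sum_const, nsmul_eq_mul] at e3
    linarith
  have h2 := abs_sum_le_card_mul (s \ t) (f := fun r => ∑ j ∈ s, a r j ^ 2) fun r hr => by
    rw [abs_of_nonneg (sum_nonneg fun _ _ => sq_nonneg _)]; exact h1 r hr
  rw [hcard] at h2
  have h3 := (le_abs_self _).trans h2
  have h4 := sum_sdiff hts (f := fun p => ∑ q ∈ s, a p q ^ 2)
  have h5 : ∑ p ∈ t, ∑ q ∈ s, a p q ^ 2 = ∑ p ∈ t, ∑ q ∈ s \ t, a p q ^ 2 + sumSq a t := by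
    rw [sumSq, ← sum_add_distrib]
    exact sum_congr rfl fun p _ => (sum_sdiff hts (f := fun q => a p q ^ 2)).symm
  have h6 : ∑ p ∈ t, ∑ q ∈ s \ t, a p q ^ 2 ≤ ∑ r ∈ s \ t, ∑ j ∈ s, a r j ^ 2 := by
    rw [sum_comm]
    refine sum_le_sum fun r _ => ?_
    simp_rw [fun p => ha p r]
    exact sum_le_sum_of_subset_of_nonneg hts fun _ _ _ => sq_nonneg _
  push_cast at h3
  simp only [sumSq] at *
  linarith

/-- Removing four vertices changes the statistic of a large normalized array little. -/
lemma restrict_estimates (ha : IsCentered a s) (hs : Even #s) (hN : 100000 ≤ #s)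
    (hvar : avg s (fun π => matchSum a s π ^ 2) = 1) (hB : sumCube a s ≤ #s / 10000000)
    (hts : t ⊆ s) (hcard : #(s \ t) = 4) :
    1 / 10 ≤ avg t (fun π => matchSum (recenter a t) t π ^ 2) ∧
      avg t (fun π => |matchSum a t π|) ≤ 5 ∧
      sumCube (recenter a t) t ≤ 5 * sumCube a s := by
  have hN' : (100000 : ℝ) ≤ #s := by exact_mod_cast hN
  have hcard' := card_sdiff_add_card_eq_card hts
  rw [hcard] at hcard'
  have hct : (#t : ℝ) = #s - 4 := by rw [← hcard']; push_cast; ring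
  have ht : Even #t := by
    obtain ⟨m, hm⟩ := hs
    exact ⟨m - 2, by omega⟩
  obtain ⟨b, hb0, hbB, hb⟩ := exists_entry_bound a s
  have hb2 : b ^ 2 ≤ #s / 100000 := by
    refine le_of_pow_le_pow_left₀ three_ne_zero (by positivity) ?_
    have e1 : b ^ 3 ≤ #s / 10000000 := hbB.trans hB
    have e2 : (b ^ 3) ^ 2 ≤ (#s / 10000000) ^ 2 := pow_le_pow_left₀ (by positivity) e1 2
    have e3 : ((#s : ℝ) / 10000000) ^ 2 ≤ (#s / 100000) ^ 3 := by
      have : 0 ≤ (#s : ℝ) ^ 2 * (#s - 100000) := by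
        have : 0 ≤ (#s : ℝ) - 100000 := by linarith
        positivity
      nlinarith
    calc (b ^ 2) ^ 3 = (b ^ 3) ^ 2 := by ring
      _ ≤ _ := e2.trans e3
  have hb1 : 16 * b ≤ #s - 5 := by
    refine (le_abs_self _).trans (abs_le_of_sq_le_sq ?_ (by linarith))
    nlinarith
  have hc := fun p (hp : p ∈ t) =>
    abs_rowShift_restrict_le ha hts hcard (by omega) hb0 hb hp
  have hd := fun p (hp : p ∈ t) q (hq : q ∈ t) => abs_sub_recenter_le ha.diag hb0 hc hp hq
  have hcen := isCentered_recenter ha.symm ha.diag (s := t) (by omega)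
  obtain ⟨v1, v2⟩ := variance_bounds hcen ht (by omega)
  obtain ⟨w1, -⟩ := variance_bounds ha hs (by omega)
  obtain ⟨u1, u2⟩ := sumSq_recenter_le hts (by omega) hd
  have h1 := sumSq_ge ha hs hvar
  have h2 := sumSq_restrict_ge ha.symm hts hcard
  rw [hvar] at w1
  set v := avg t (fun π => matchSum (recenter a t) t π ^ 2)
  rw [hct] at v1 v2
  have hv9 : v ≤ 9 := by nlinarith
  have hv0 : 1 / 10 ≤ v := by nlinarith
  refine ⟨hv0, ?_, sumCube_recenter_le hts (by omega) hb0 hbB hd⟩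
  have h3 := abs_total_restrict_le ha hts hcard hb
  have h4 : |(∑ p ∈ t, ∑ q ∈ t, a p q) / ((#t : ℝ) - 1)| ≤ 1 := by
    rw [hct, abs_div, div_le_one (by rw [abs_pos]; linarith), abs_of_pos (by linarith : (0 : ℝ)
      < #s - 4 - 1)]
    linarith
  have h5 : avg t (fun π => |matchSum (recenter a t) t π|) ≤ 3 := by
    refine (le_abs_self _).trans (abs_le_of_sq_le_sq ?_ (by norm_num))
    refine (sq_avg_le ht _).trans ?_
    simp only [sq_abs]
    linarith
  calc avg t (fun π => |matchSum a t π|)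
      ≤ avg t (fun π => |matchSum (recenter a t) t π| + 1) := avg_mono fun π hπ => by
        rw [matchSum_eq_recenter a (by omega) hπ]
        exact (abs_add_le _ _).trans (by linarith)
    _ ≤ 5 := by rw [avg_add, avg_const ht]; linarith

end Restrict

/-! ### Conditioning on two pairs -/

lemma sum_matchings_le_of_fiber {s : Finset V} {i : V} (hi : i ∈ s) {g h : Equiv.Perm V → ℝ}
    (H : ∀ l ∈ s.erase i, ∑ ρ ∈ matchings ((s.erase i).erase l), g (ρ * Equiv.swap i l)
      ≤ ∑ ρ ∈ matchings ((s.erase i).erase l), h (ρ * Equiv.swap i l)) :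
    ∑ π ∈ matchings s, g π ≤ ∑ π ∈ matchings s, h π := by
  have hmaps : ∀ π ∈ matchings s, π i ∈ s.erase i := fun π hπ =>
    mem_erase.2 ⟨matchings_apply_ne hπ hi, matchings_apply_mem hπ hi⟩
  rw [← sum_fiberwise_of_maps_to hmaps, ← sum_fiberwise_of_maps_to hmaps h]
  refine sum_le_sum fun l hl => ?_
  obtain ⟨hli, hls⟩ := mem_erase.1 hl
  rw [sum_matchings_filter hi hls hli.symm, sum_matchings_filter hi hls hli.symm]
  exact H l hl

lemma matchSum_mul_swap {a : V → V → ℝ} (ha : ∀ i j, a i j = a j i) {s : Finset V} {i l : V}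
    (hi : i ∈ s) (hl : l ∈ s) (hil : i ≠ l) {ρ : Equiv.Perm V}
    (hρ : ρ ∈ matchings ((s.erase i).erase l)) :
    matchSum a s (ρ * Equiv.swap i l) = matchSum a ((s.erase i).erase l) ρ + 2 * a i l := by
  have h1 : ρ i = i := ((mem_matchings.1 hρ).2 i).2 (by simp)
  have h2 : ρ l = l := ((mem_matchings.1 hρ).2 l).2 (by simp)
  have hl' : l ∈ s.erase i := mem_erase.2 ⟨hil.symm, hl⟩
  rw [matchSum, ← add_sum_erase s _ hi, ← add_sum_erase _ _ hl']
  simp only [Equiv.Perm.mul_apply, Equiv.swap_apply_left, Equiv.swap_apply_right, h1, h2]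
  rw [matchSum, sum_congr rfl fun x hx => ?_, ha l i]
  · ring
  · have h3 := ne_of_mem_erase hx
    have h4 := ne_of_mem_erase (mem_of_mem_erase hx)
    rw [Equiv.swap_apply_of_ne_of_ne h4 h3]

lemma avg_le_of_pair_fiber {s : Finset V} {i k : V} (hi : i ∈ s) (hk : k ∈ s) (hik : i ≠ k)
    {g h : Equiv.Perm V → ℝ} (h0 : ∀ π ∈ matchings s, π i = k → π k = i → g π ≤ h π)
    (H : ∀ l m t, l ∈ s → m ∈ s → t = (((s.erase i).erase l).erase k).erase m →
      t ⊆ s → #(s \ t) = 4 →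
      (∀ τ ∈ matchings t, ∃ π ∈ matchings s, π = τ * Equiv.swap k m * Equiv.swap i l ∧
        π i = l ∧ π k = m ∧ ∀ a : V → V → ℝ, (∀ p q, a p q = a q p) →
          matchSum a s π = matchSum a t τ + 2 * (a i l + a k m)) →
      avg t (fun τ => g (τ * Equiv.swap k m * Equiv.swap i l))
        ≤ avg t (fun τ => h (τ * Equiv.swap k m * Equiv.swap i l))) :
    avg s g ≤ avg s h := by
  refine div_le_div_of_nonneg_right (sum_matchings_le_of_fiber hi fun l hl => ?_) (by positivity)
  obtain ⟨hli, hls⟩ := mem_erase.1 hl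
  rcases eq_or_ne l k with rfl | hlk
  · refine sum_le_sum fun ρ hρ => h0 _ (mul_swap_mem_matchings hi hls hli.symm hρ) ?_ ?_
    · simpa using ((mem_matchings.1 hρ).2 l).2 (by simp)
    · simpa using ((mem_matchings.1 hρ).2 i).2 (by simp)
  have hk1 : k ∈ (s.erase i).erase l := by simp [hk, hik.symm, hlk.symm]
  refine sum_matchings_le_of_fiber hk1
    (g := fun ρ => g (ρ * Equiv.swap i l)) (h := fun ρ => h (ρ * Equiv.swap i l)) fun m hm => ?_
  simp only [mem_erase] at hm
  obtain ⟨hmk, hml, hmi, hms⟩ := hm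
  set t := (((s.erase i).erase l).erase k).erase m with ht
  have hsd : s \ t = {i, l, k, m} := by
    ext x
    simp only [ht, Finset.mem_sdiff, mem_erase, mem_insert, mem_singleton]
    constructor
    · rintro ⟨h1, h2⟩; by_contra h3; push Not at h3; exact h2 ⟨h3.2.2.2, h3.2.2.1, h3.2.1, h3.1, h1⟩
    · rintro (rfl | rfl | rfl | rfl) <;> simp [*]
  have key := H l m t hls hms ht (fun x hx => by simp only [ht, mem_erase] at hx; tauto)
    (by
      rw [hsd, card_insert_of_notMem (by simp [hli.symm, hik, hmi.symm]),
        card_insert_of_notMem (by simp [hlk, hml.symm]), card_pair hmk.symm]) fun τ hτ => by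
      have hm1 : m ∈ (s.erase i).erase l := by simp [*]
      have hρ := mul_swap_mem_matchings hk1 hm1 hmk.symm hτ
      refine ⟨_, mul_swap_mem_matchings hi hls hli.symm hρ, rfl, ?_, ?_, fun a ha => ?_⟩
      · simpa [Equiv.swap_apply_of_ne_of_ne hlk hml.symm] using
          ((mem_matchings.1 hτ).2 l).2 (by simp [ht])
      · simpa [Equiv.swap_apply_of_ne_of_ne hik.symm hlk.symm] using
          ((mem_matchings.1 hτ).2 m).2 (by simp [ht])
      · rw [matchSum_mul_swap ha hi hls hli.symm hρ, matchSum_mul_swap ha hk1 hm1 hmk.symm hτ]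
        ring
  rcases (matchings t).eq_empty_or_nonempty with he | he
  · simp [he]
  · exact (div_le_div_iff_of_pos_right (by exact_mod_cast he.card_pos)).1 key

/-! ### Concentration and averaged oscillation -/

lemma Monotone.integral_shift_sub_le {G : ℝ → ℝ} (hG : Monotone G) {r Q d : ℝ} (hd : 0 ≤ d)
    (hQ : ∀ y, G (y + r) - G y ≤ Q) (z : ℝ) :
    ∫ u in z..z + r, (G (u + d) - G u) ≤ d * Q := by
  have hi : ∀ x y, IntervalIntegrable G volume x y := fun x y => hG.intervalIntegrable
  have hi' : ∀ e x y, IntervalIntegrable (fun u => G (u + e)) volume x y := fun e x y =>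
    (hG.comp (fun _ _ h => by linarith : Monotone fun u : ℝ => u + e)).intervalIntegrable
  have h1 : ∫ u in z..z + r, (G (u + d) - G u) = ∫ u in z..z + d, (G (u + r) - G u) := by
    rw [intervalIntegral.integral_sub (hi' d _ _) (hi _ _),
      intervalIntegral.integral_sub (hi' r _ _) (hi _ _),
      intervalIntegral.integral_comp_add_right, intervalIntegral.integral_comp_add_right]
    have e1 := intervalIntegral.integral_add_adjacent_intervals
      (hi z (z + d)) (hi (z + d) (z + r + d))
    have e2 := intervalIntegral.integral_add_adjacent_intervals
      (hi z (z + r)) (hi (z + r) (z + r + d))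
    rw [show z + d + r = z + r + d by ring]
    linarith
  rw [h1]
  refine (intervalIntegral.integral_mono_on (by linarith) ((hi' r _ _).sub (hi _ _))
    intervalIntegrable_const fun u _ => hQ u).trans_eq ?_
  simp

lemma Monotone.integral_abs_shift_sub_le {G : ℝ → ℝ} (hG : Monotone G) {r Q : ℝ}
    (hQ : ∀ y, G (y + r) - G y ≤ Q) (x y z : ℝ) :
    ∫ u in z..z + r, |G (u - x) - G (u - y)| ≤ |x - y| * Q := by
  wlog h : x ≤ y generalizing x y
  · simpa only [abs_sub_comm] using this y x (not_le.1 h).le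
  have h1 : ∀ u, |G (u - x) - G (u - y)| = G (u - y + (y - x)) - G (u - y) := fun u => by
    rw [sub_add_sub_cancel, abs_of_nonneg (sub_nonneg.2 (hG (by linarith)))]
  simp only [h1]
  rw [intervalIntegral.integral_comp_sub_right (fun u => G (u + (y - x)) - G u) y,
    abs_sub_comm, abs_of_nonneg (sub_nonneg.2 h), show z + r - y = z - y + r by ring]
  exact hG.integral_shift_sub_le (sub_nonneg.2 h) hQ _

lemma monotone_matchCDF (a : V → V → ℝ) (s : Finset V) : Monotone (matchCDF a s) := by
  intro x y hxy
  refine avg_mono fun π _ => ?_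
  split_ifs <;> linarith

lemma avg_abs_indicator_sub (a : V → V → ℝ) (t : Finset V) (x y u : ℝ) :
    avg t (fun τ => |(if matchSum a t τ + x ≤ u then (1 : ℝ) else 0)
      - (if matchSum a t τ + y ≤ u then 1 else 0)|)
      = |matchCDF a t (u - x) - matchCDF a t (u - y)| := by
  wlog h : x ≤ y generalizing x y
  · simpa only [abs_sub_comm] using this y x (not_le.1 h).le
  rw [abs_of_nonneg (sub_nonneg.2 (monotone_matchCDF a t (by linarith))), matchCDF, matchCDF,
    ← avg_sub]
  refine avg_congr fun τ _ => ?_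
  rw [abs_of_nonneg]
  · simp only [le_sub_iff_add_le]
  · split_ifs <;> linarith

lemma avg_integral_steinOsc_le (a : V → V → ℝ) {t : Finset V} (ht : Even #t) {r M Q : ℝ}
    (hr : 0 ≤ r) (hM : avg t (fun τ => |matchSum a t τ|) ≤ M)
    (hQ : ∀ y, matchCDF a t (y + r) - matchCDF a t y ≤ Q) (z c d : ℝ) :
    avg t (fun τ => ∫ u in z..z + r, steinOsc u (matchSum a t τ + c) d)
      ≤ r * (|d| * (2 * M + 5) + 2 * |c|) + |d| * Q := by
  have hzr : z ≤ z + r := by linarith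
  have hi : ∀ τ, IntervalIntegrable (fun u => |(if matchSum a t τ + (c + d) ≤ u then (1 : ℝ) else 0)
      - (if matchSum a t τ + c ≤ u then 1 else 0)|) volume z (z + r) := fun τ =>
    (integrable_indicator_sub_indicator _ _).abs.intervalIntegrable
  have h1 : ∀ τ, ∫ u in z..z + r, steinOsc u (matchSum a t τ + c) d
      ≤ r * (|d| * (2 * |matchSum a t τ| + 5) + 2 * |c|)
        + ∫ u in z..z + r, |(if matchSum a t τ + (c + d) ≤ u then (1 : ℝ) else 0)
          - (if matchSum a t τ + c ≤ u then 1 else 0)| := fun τ => by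
    refine (intervalIntegral.integral_mono_on hzr (integrable_steinOsc _ _).intervalIntegrable
      (intervalIntegrable_const.add (hi τ)) fun u _ => add_le_add
        (abs_mul_steinSol_sub_le u (matchSum a t τ) c d) (by rw [add_assoc])).trans_eq ?_
    rw [intervalIntegral.integral_add intervalIntegrable_const (hi τ)]
    simp only [intervalIntegral.integral_const, add_sub_cancel_left, smul_eq_mul]
  refine (avg_mono fun τ _ => h1 τ).trans ?_
  rw [avg_add]
  refine add_le_add ?_ ?_
  · rw [avg_const_mul, avg_add, avg_const_mul, avg_add, avg_const_mul, avg_const ht, avg_const ht]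
    gcongr
  · have h2 := integral_avg (s := t) (μ := volume.restrict (Set.Ioc z (z + r))) fun τ _ =>
      (intervalIntegrable_iff_integrableOn_Ioc_of_le hzr).1 (hi τ)
    simp only [intervalIntegral.integral_of_le hzr]
    rw [← h2, ← intervalIntegral.integral_of_le hzr]
    simp only [avg_abs_indicator_sub]
    refine ((monotone_matchCDF a t).integral_abs_shift_sub_le hQ _ _ _).trans_eq ?_
    rw [add_sub_cancel_left]

lemma avg_mul_integral_steinOsc_le {a : V → V → ℝ} {s : Finset V} (ha : IsCentered a s)
    (hs : Even #s) {i k : V} (hi : i ∈ s) (hk : k ∈ s) (hik : i ≠ k) {r M Q : ℝ} (hr : 0 ≤ r)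
    (hM0 : 0 ≤ M) (hQ0 : 0 ≤ Q)
    (hM : ∀ t ⊆ s, #(s \ t) = 4 → avg t (fun τ => |matchSum a t τ|) ≤ M)
    (hQ : ∀ t ⊆ s, #(s \ t) = 4 → ∀ y, matchCDF a t (y + r) - matchCDF a t y ≤ Q) (z : ℝ) :
    avg s (fun π => |a i k| * |matchIncr a i k π|
        * ∫ u in z..z + r, steinOsc u (matchSum a s π) (matchIncr a i k π))
      ≤ (r * (2 * M + 7) + Q) * avg s (incrWeight a i k) := by
  have hw : ∀ π, 0 ≤ incrWeight a i k π := fun π => by unfold incrWeight; positivity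
  rw [← avg_const_mul]
  refine avg_le_of_pair_fiber hi hk hik (fun π _ hπi hπk => ?_)
    fun l m t hl hm ht hts hcard hτ => ?_
  · have : matchIncr a i k π = 0 := by rw [matchIncr, hπi, hπk, ha.symm k i]; ring
    rw [this, abs_zero, mul_zero, zero_mul]
    exact mul_nonneg (by positivity) (hw π)
  have hte : Even #t := by
    have := card_sdiff_add_card_eq_card hts
    rw [hcard] at this
    rw [← this] at hs
    obtain ⟨q, hq⟩ := hs
    exact ⟨q - 2, by omega⟩
  set d := 2 * (a i k + a l m - a i l - a k m) with hd
  set S := |a i k| + |a l m| + |a i l| + |a k m| with hS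
  set c := 2 * (a i l + a k m) with hc
  have hdS : |d| ≤ 2 * S := by
    rw [hd, abs_mul, abs_two]
    gcongr
    exact (abs_sub _ _).trans (add_le_add_left ((abs_sub _ _).trans
      (add_le_add_left (abs_add_le _ _) _)) _)
  have hcS : |c| ≤ 2 * S := by
    rw [hc, abs_mul, abs_two]
    gcongr
    linarith [abs_add_le (a i l) (a k m), abs_nonneg (a i k), abs_nonneg (a l m)]
  have h1 : avg t (fun τ => |a i k| * |matchIncr a i k (τ * Equiv.swap k m * Equiv.swap i l)|
        * ∫ u in z..z + r, steinOsc u (matchSum a s (τ * Equiv.swap k m * Equiv.swap i l))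
          (matchIncr a i k (τ * Equiv.swap k m * Equiv.swap i l)))
      = avg t fun τ => |a i k| * |d| * ∫ u in z..z + r, steinOsc u (matchSum a t τ + c) d := by
    refine avg_congr fun τ h => ?_
    obtain ⟨π, -, hπ, e1, e2, e3⟩ := hτ τ h
    rw [← hπ, e3 a ha.symm, matchIncr, e1, e2]
  have h2 : avg t (fun τ => (r * (2 * M + 7) + Q)
        * incrWeight a i k (τ * Equiv.swap k m * Equiv.swap i l))
      = (r * (2 * M + 7) + Q) * (|a i k| * (4 * S ^ 2)) := by
    rw [← avg_const hte ((r * (2 * M + 7) + Q) * (|a i k| * (4 * S ^ 2)))]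
    refine avg_congr fun τ h => ?_
    obtain ⟨π, -, hπ, e1, e2, -⟩ := hτ τ h
    rw [← hπ, incrWeight, e1, e2]
  rw [h1, h2, avg_const_mul]
  have h3 := avg_integral_steinOsc_le a hte hr (hM t hts hcard) (hQ t hts hcard) z c d
  refine (mul_le_mul_of_nonneg_left h3 (by positivity)).trans ?_
  have hd2 : |d| * |d| ≤ 4 * S ^ 2 := by nlinarith [abs_nonneg d]
  have hdc : |d| * |c| ≤ 4 * S ^ 2 := by nlinarith [abs_nonneg d, abs_nonneg c]
  calc |a i k| * |d| * (r * (|d| * (2 * M + 5) + 2 * |c|) + |d| * Q)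
      = |a i k| * (r * (2 * M + 5) * (|d| * |d|) + r * 2 * (|d| * |c|) + Q * (|d| * |d|)) := by ring
    _ ≤ |a i k| * (r * (2 * M + 5) * (4 * S ^ 2) + r * 2 * (4 * S ^ 2) + Q * (4 * S ^ 2)) := by
        gcongr
    _ = _ := by ring

/-! ### The uniform bound -/

lemma integral_abs_matchCDF_sub_interval_le {a : V → V → ℝ} {s : Finset V} (ha : IsCentered a s)
    (hs : Even #s) (hN : 10 ≤ #s) (hvar : avg s (fun π => matchSum a s π ^ 2) = 1)
    {r M Q : ℝ} (hr : 0 ≤ r) (hM0 : 0 ≤ M) (hQ0 : 0 ≤ Q)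
    (hM : ∀ t ⊆ s, #(s \ t) = 4 → avg t (fun τ => |matchSum a t τ|) ≤ M)
    (hQ : ∀ t ⊆ s, #(s \ t) = 4 → ∀ y, matchCDF a t (y + r) - matchCDF a t y ≤ Q) (z : ℝ) :
    ((#s : ℝ) - 1) * ∫ u in z..z + r, |matchCDF a s u - stdNormalCDF u|
      ≤ (44 * r + 67 * (r * (2 * M + 7) + Q)) * sumCube a s := by
  have hzr : z ≤ z + r := by linarith
  set μ := volume.restrict (Set.Ioc z (z + r)) with hμ
  set m := avg s (pairSum a s) with hm
  have hB := sumCube_nonneg a s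
  have hi1 : ∀ π, Integrable (fun u => 2 * (|m - pairSum a s π| * |steinDeriv u (matchSum a s π)|))
      μ := fun π => (((integrable_steinDeriv _).abs.const_mul _).const_mul _).integrableOn
  have hi2 : ∀ π i k, Integrable (fun u => |a i k| * |matchIncr a i k π|
            * steinOsc u (matchSum a s π) (matchIncr a i k π)) μ :=
    fun π i k => ((integrable_steinOsc _ _).const_mul _).integrableOn
  have hi3 : ∀ π i, Integrable (fun u => ∑ k ∈ s, |a i k| * |matchIncr a i k π|
            * steinOsc u (matchSum a s π) (matchIncr a i k π)) μ :=
    fun π i => integrable_finsetSum _ fun k _ => hi2 π i k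
  have hi4 : ∀ π, Integrable (fun u => ∑ i ∈ s, ∑ k ∈ s, |a i k| * |matchIncr a i k π|
            * steinOsc u (matchSum a s π) (matchIncr a i k π)) μ :=
    fun π => integrable_finsetSum _ fun i _ => hi3 π i
  have h1 : ((#s : ℝ) - 1) * ∫ u in z..z + r, |matchCDF a s u - stdNormalCDF u|
      ≤ avg s fun π => 4 * r * |m - pairSum a s π|
        + ∑ i ∈ s, ∑ k ∈ s, |a i k| * |matchIncr a i k π|
          * ∫ u in z..z + r, steinOsc u (matchSum a s π) (matchIncr a i k π) := by
    simp only [intervalIntegral.integral_of_le hzr, ← hμ]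
    rw [← integral_const_mul]
    refine (integral_mono ((integrable_matchCDF_sub a hs).abs.const_mul _).integrableOn
      (integrable_avg fun π _ => (hi1 π).add (hi4 π))
      (abs_matchCDF_sub_le ha hs hN hvar)).trans ?_
    refine (integral_avg fun π _ => (hi1 π).add (hi4 π)).trans_le (avg_mono fun π _ => ?_)
    simp only [Pi.add_apply]
    rw [integral_add (hi1 π) (hi4 π), integral_finsetSum _ fun i _ => hi3 π i]
    refine add_le_add ?_ (sum_le_sum fun i _ => ?_)
    · refine (integral_mono (hi1 π) (integrable_const (4 * |m - pairSum a s π|))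
        fun u => ?_).trans_eq ?_
      · have := mul_le_mul_of_nonneg_left (abs_steinDeriv_le u (matchSum a s π))
          (abs_nonneg (m - pairSum a s π))
        dsimp only
        linarith
      · rw [hμ, integral_const, measureReal_restrict_apply_univ, Real.volume_real_Ioc_of_le hzr,
          smul_eq_mul]
        ring
    · rw [integral_finsetSum _ fun k _ => hi2 π i k]
      exact (sum_congr rfl fun k _ => integral_const_mul _ _).le
  have h2 : avg s (fun π => |m - pairSum a s π|) ≤ 11 * sumCube a s := by
    refine abs_le_of_sq_le_sq' ((sq_avg_le hs _).trans ?_) (by positivity) |>.2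
    simpa only [sq_abs] using avg_pairSum_sub_sq_le ha hs hN hvar
  have h3 : ∀ i ∈ s, ∀ k ∈ s, avg s (fun π => |a i k| * |matchIncr a i k π|
          * ∫ u in z..z + r, steinOsc u (matchSum a s π) (matchIncr a i k π))
      ≤ (r * (2 * M + 7) + Q) * avg s (incrWeight a i k) := by
    intro i hi k hk
    rcases eq_or_ne i k with rfl | hik
    · simp only [ha.diag, abs_zero, zero_mul]
      rw [avg_const hs]
      refine mul_nonneg (by positivity) (avg_nonneg fun π _ => ?_)
      rw [incrWeight]; positivity
    · exact avg_mul_integral_steinOsc_le ha hs hi hk hik hr hM0 hQ0 hM hQ z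
  have h4 := avg_incrWeight_le (a := a) hs hN
  have h5 := sum_le_sum fun i hi => sum_le_sum fun k hk => h3 i hi k hk
  simp only [← mul_sum] at h5
  rw [avg_add, avg_const_mul] at h1
  simp only [avg_sum] at h1 h4
  refine h1.trans ?_
  have h6 := mul_le_mul_of_nonneg_left h2 (by positivity : 0 ≤ 4 * r)
  have h7 := mul_le_mul_of_nonneg_left h4 (by positivity : 0 ≤ r * (2 * M + 7) + Q)
  linarith

lemma Monotone.abs_sub_stdNormalCDF_le {F : ℝ → ℝ} (hF : Monotone F) {r ε : ℝ} (hr : 0 < r)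
    (h : ∀ z, ∫ u in z..z + r, |F u - stdNormalCDF u| ≤ r * ε) (z : ℝ) :
    |F z - stdNormalCDF z| ≤ ε + 2 / 5 * r := by
  have hi : ∀ x y, IntervalIntegrable (fun u => |F u - stdNormalCDF u|) volume x y := fun x y =>
    (hF.intervalIntegrable.sub monotone_stdNormalCDF.intervalIntegrable).abs
  have key : ∀ x c, (∀ u ∈ Set.Icc x (x + r), c - 2 / 5 * r ≤ |F u - stdNormalCDF u|) →
      c ≤ ε + 2 / 5 * r := by
    intro x c hc
    have h1 := intervalIntegral.integral_mono_on (by linarith) intervalIntegrable_const (hi _ _) hc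
    rw [intervalIntegral.integral_const, add_sub_cancel_left, smul_eq_mul] at h1
    linarith [le_of_mul_le_mul_left (h1.trans (h x)) hr]
  refine abs_sub_le_iff.2 ⟨key z _ fun u hu => ?_, key (z - r) _ fun u hu => ?_⟩
  · have h1 := hF hu.1
    have h2 := stdNormalCDF_sub_le hu.1
    have h3 := le_abs_self (F u - stdNormalCDF u)
    linarith [hu.2]
  · have hu' : u ≤ z := by linarith [hu.2]
    have h1 := hF hu'
    have h2 := stdNormalCDF_sub_le hu'
    have h3 := neg_le_abs (F u - stdNormalCDF u)
    linarith [hu.1]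

lemma card_ge_of_sumCube_le {a : V → V → ℝ} {s : Finset V} (ha : IsCentered a s) (hs : Even #s)
    (hN : 10 ≤ #s) (hvar : avg s (fun π => matchSum a s π ^ 2) = 1)
    (hB : sumCube a s ≤ #s / 10000000) : 100000 ≤ #s := by
  have hN' : (10 : ℝ) ≤ #s := by exact_mod_cast hN
  have h1 := sumSq_ge ha hs hvar
  have h2 := sumSq_pow_three_le a s
  have h3 := sumCube_nonneg a s
  have h4 : (9 / 40 * (#s : ℝ)) ^ 3 ≤ (#s / 10000000 * #s) ^ 2 :=
    (pow_le_pow_left₀ (by positivity) (by linarith) 3).trans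
      (h2.trans (pow_le_pow_left₀ (by positivity) (by gcongr) 2))
  have h5 : (#s : ℝ) ^ 3 * (9 / 40) ^ 3 ≤ (#s : ℝ) ^ 3 * (#s / 10000000 ^ 2) := by
    calc _ = (9 / 40 * (#s : ℝ)) ^ 3 := by ring
      _ ≤ _ := h4
      _ = _ := by ring
  have h6 := le_of_mul_le_mul_left h5 (by positivity)
  have : (100000 : ℝ) ≤ #s := by linarith
  exact_mod_cast this

lemma matchCDF_restrict_sub_le {a : V → V → ℝ} {s t : Finset V} {K r : ℝ} (hK : 0 ≤ K)
    (hr : 0 ≤ r) (ha : IsCentered a s) (hs : Even #s) (hN : 100000 ≤ #s)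
    (hvar : avg s (fun π => matchSum a s π ^ 2) = 1) (hB : sumCube a s ≤ #s / 10000000)
    (hts : t ⊆ s) (hcard : #(s \ t) = 4)
    (IH : ∀ a' : V → V → ℝ, IsCentered a' t → avg t (fun π => matchSum a' t π ^ 2) = 1 →
      ∀ u, |matchCDF a' t u - stdNormalCDF u| ≤ K * (sumCube a' t / #t)) (y : ℝ) :
    matchCDF a t (y + r) - matchCDF a t y ≤ 2 * r + 330 * (K * (sumCube a s / #s)) := by
  have hN' : (100000 : ℝ) ≤ #s := by exact_mod_cast hN
  obtain ⟨hv, -, hc⟩ := restrict_estimates ha hs hN hvar hB hts hcard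
  have hct := card_sdiff_add_card_eq_card hts
  rw [hcard] at hct
  have ht3 : 3 ≤ #t := by omega
  have hct' : (#t : ℝ) = #s - 4 := by rw [← hct]; push_cast; ring
  set v := avg t (fun π => matchSum (recenter a t) t π ^ 2) with hvdef
  have hv0 : 0 < v := by linarith
  have hB0 := sumCube_nonneg a s
  have hinv : (√v)⁻¹ ≤ 16 / 5 := by
    rw [inv_le_comm₀ (Real.sqrt_pos.2 hv0) (by norm_num)]
    exact Real.le_sqrt_of_sq_le (by norm_num; linarith)
  have hinv0 : 0 ≤ (√v)⁻¹ := by positivity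
  have h1 := IH _ ((isCentered_recenter ha.symm ha.diag ht3).const_mul (√v)⁻¹)
    (avg_normalize_sq hv0 hvdef.symm)
  have h2 : sumCube (fun i j => (√v)⁻¹ * recenter a t i j) t ≤ 164 * sumCube a s := by
    rw [sumCube_const_mul _ _ hinv0]
    calc (√v)⁻¹ ^ 3 * sumCube (recenter a t) t ≤ (16 / 5) ^ 3 * (5 * sumCube a s) := by
          gcongr; exact sumCube_nonneg _ _
      _ ≤ _ := by linarith
  have h3 : sumCube (fun i j => (√v)⁻¹ * recenter a t i j) t / #t ≤ 165 * (sumCube a s / #s) := by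
    rw [hct', ← mul_div_assoc, div_le_div_iff₀ (by linarith) (by linarith)]
    nlinarith
  have h4 : ∀ u, |matchCDF (fun i j => (√v)⁻¹ * recenter a t i j) t u - stdNormalCDF u|
      ≤ 165 * (K * (sumCube a s / #s)) := fun u =>
    (h1 u).trans ((mul_le_mul_of_nonneg_left h3 hK).trans_eq (by ring))
  rw [matchCDF_recenter a ht3, matchCDF_recenter a ht3]
  refine (matchCDF_sub_le hv0 h4 (by linarith)).trans ?_
  have h5 := mul_le_mul_of_nonneg_right hinv hr
  rw [show y + r - (∑ i ∈ t, ∑ j ∈ t, a i j) / (#t - 1)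
    - (y - (∑ i ∈ t, ∑ j ∈ t, a i j) / (#t - 1)) = r by ring]
  linarith

lemma matchCDF_nonneg (a : V → V → ℝ) (s : Finset V) (z : ℝ) : 0 ≤ matchCDF a s z :=
  avg_nonneg fun π _ => by split_ifs <;> norm_num

lemma matchCDF_le_one (a : V → V → ℝ) {s : Finset V} (hs : Even #s) (z : ℝ) :
    matchCDF a s z ≤ 1 := by
  rw [← avg_const hs 1]
  refine avg_mono fun π _ => ?_
  split_ifs <;> norm_num

/-- The uniform bound for a centered array with unit variance. -/
theorem abs_matchCDF_sub_stdNormalCDF_le {a : V → V → ℝ} {s : Finset V} (ha : IsCentered a s)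
    (hs : Even #s) (hN : 10 ≤ #s) (hvar : avg s (fun π => matchSum a s π ^ 2) = 1) (z : ℝ) :
    |matchCDF a s z - stdNormalCDF z| ≤ 61702446 * (sumCube a s / #s) := by
  induction s using Finset.strongInduction generalizing a z with
  | H s IH =>
  have hN' : (10 : ℝ) ≤ #s := by exact_mod_cast hN
  set δ := sumCube a s / #s with hδ
  have hδ0 : 0 ≤ δ := div_nonneg (sumCube_nonneg a s) (by positivity)
  have hB : sumCube a s = δ * #s := by rw [hδ]; field_simp
  rcases le_total 1 (61702446 * δ) with hbig | hsmall
  · refine le_trans (abs_sub_le_iff.2 ⟨?_, ?_⟩) hbig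
    · linarith [stdNormalCDF_nonneg z, matchCDF_le_one a hs z]
    · linarith [stdNormalCDF_le_one z, matchCDF_nonneg a s z]
  have hB' : sumCube a s ≤ #s / 10000000 := by
    rw [hB]; nlinarith
  have hδpos : 0 < δ := by
    refine hδ0.lt_of_ne fun h0 => ?_
    rw [← h0, zero_mul] at hB
    have h1 := sumSq_ge ha hs hvar
    have h2 := sumSq_pow_three_le a s
    rw [hB] at h2
    have h3 : (0 : ℝ) < sumSq a s ^ 3 := pow_pos (by linarith) 3
    norm_num at h2
    linarith
  have hN5 := card_ge_of_sumCube_le ha hs hN hvar hB'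
  set r := 10000000 * δ with hr
  have hr0 : 0 < r := by positivity
  have hQ : ∀ t ⊆ s, #(s \ t) = 4 → ∀ y,
      matchCDF a t (y + r) - matchCDF a t y ≤ 2 * r + 330 * (61702446 * δ) := by
    intro t hts hcard y
    have hct := card_sdiff_add_card_eq_card hts
    rw [hcard] at hct
    have hne : t ≠ s := by rintro rfl; simp at hcard
    refine matchCDF_restrict_sub_le (by norm_num) hr0.le ha hs hN5 hvar hB' hts hcard
      (fun a' ha' hv' u => IH t (hts.ssubset_of_ne hne) ha' ?_ (by omega) hv' u) y
    obtain ⟨q, hq⟩ := hs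
    exact ⟨q - 2, by omega⟩
  have h1 := integral_abs_matchCDF_sub_interval_le ha hs hN hvar hr0.le (by norm_num : (0 : ℝ) ≤ 5)
    (by positivity : 0 ≤ 2 * r + 330 * (61702446 * δ))
    (fun t hts hcard => (restrict_estimates ha hs hN5 hvar hB' hts hcard).2.1) hQ
  have h2 : ∀ z, ∫ u in z..z + r, |matchCDF a s u - stdNormalCDF u| ≤ r * (20000000 * δ) := by
    intro z
    have h3 := h1 z
    have h4 : (44 * r + 67 * (r * (2 * 5 + 7) + (2 * r + 330 * (61702446 * δ)))) * sumCube a s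
        ≤ ((#s : ℝ) - 1) * (r * (20000000 * δ)) := by
      have e : 44 * r + 67 * (r * (2 * 5 + 7) + (2 * r + 330 * (61702446 * δ))) ≤ 1000000 * r := by
        rw [hr]; linarith
      calc _ ≤ 1000000 * r * (δ * #s) := by
            rw [hB]; exact mul_le_mul_of_nonneg_right e (mul_nonneg hδ0 (Nat.cast_nonneg _))
        _ = r * δ * (1000000 * #s) := by ring
        _ ≤ r * δ * (20000000 * (#s - 1)) :=
            mul_le_mul_of_nonneg_left (by linarith) (mul_nonneg hr0.le hδ0)
        _ = _ := by ring
    exact le_of_mul_le_mul_left (h3.trans h4) (by linarith)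
  refine ((monotone_matchCDF a s).abs_sub_stdNormalCDF_le hr0 h2 z).trans ?_
  rw [hr]
  linarith

end Matchings

/-! ### The bounds for fixed-point-free involutions -/

lemma one_le_toReal {p : ℝ≥0∞} (hp : 1 ≤ p) (hptop : p ≠ ⊤) : 1 ≤ p.toReal := by
  simpa using (ENNReal.toReal_le_toReal ENNReal.one_ne_top hptop).2 hp

lemma eLpNorm_le_of_integral_abs_le_of_abs_le {D : ℝ → ℝ} (hD : Integrable D) {A B : ℝ}
    (hA : ∫ t, |D t| ≤ A) (hB : ∀ t, |D t| ≤ B) {p : ℝ≥0∞} (hp : 1 ≤ p) :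
    eLpNorm D p volume ≤ ENNReal.ofReal (A ^ (1 / p.toReal) * B ^ (1 - 1 / p.toReal)) := by
  have hA0 : 0 ≤ A := (integral_nonneg fun _ => abs_nonneg _).trans hA
  have hB0 : 0 ≤ B := (abs_nonneg _).trans (hB 0)
  rcases eq_or_ne p ⊤ with rfl | hptop
  · simpa using eLpNormEssSup_le_of_ae_bound (f := D) (Eventually.of_forall hB)
  have hp0 : p ≠ 0 := (zero_lt_one.trans_le hp).ne'
  have hq := one_le_toReal hp hptop
  rw [eLpNorm_eq_lintegral_rpow_enorm_toReal hp0 hptop]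
  set q := p.toReal
  have h1 : ∀ t, ‖D t‖ₑ ^ q ≤ ENNReal.ofReal (B ^ (q - 1)) * ‖D t‖ₑ := fun t => by
    rw [← ENNReal.ofReal_rpow_of_nonneg hB0 (by linarith)]
    calc ‖D t‖ₑ ^ q = ‖D t‖ₑ ^ (q - 1) * ‖D t‖ₑ := by
          rw [← ENNReal.rpow_one ‖D t‖ₑ, ← ENNReal.rpow_mul, one_mul, ← ENNReal.rpow_mul, one_mul,
            ← ENNReal.rpow_add_of_nonneg _ _ (by linarith) zero_le_one, sub_add_cancel]
      _ ≤ _ := by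
          gcongr
          rw [Real.enorm_eq_ofReal_abs]
          exact ENNReal.ofReal_le_ofReal (hB t)
  have h2 : ∫⁻ t, ‖D t‖ₑ ≤ ENNReal.ofReal A := by
    rw [← ofReal_integral_norm_eq_lintegral_enorm hD]
    exact ENNReal.ofReal_le_ofReal hA
  have h3 : ∫⁻ t, ‖D t‖ₑ ^ q ≤ ENNReal.ofReal (B ^ (q - 1) * A) := by
    refine (lintegral_mono h1).trans ?_
    rw [lintegral_const_mul' _ _ ENNReal.ofReal_ne_top, ENNReal.ofReal_mul (by positivity)]
    gcongr
  refine (ENNReal.rpow_le_rpow h3 (by positivity)).trans_eq ?_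
  rw [ENNReal.ofReal_rpow_of_nonneg (by positivity) (by positivity),
    Real.mul_rpow (by positivity) hA0, ← Real.rpow_mul hB0, mul_comm]
  congr 3
  field_simp

lemma fpfInvolutions_eq_matchings (n : ℕ) : fpfInvolutions n = matchings univ := by
  ext π
  simp [fpfInvolutions, mem_matchings, Equiv.ext_iff]

/-- L^p bounds (1 ≤ p ≤ ∞) for the CLT with fixed-point-free involutions. -/
theorem lp_bound_involutions (n : ℕ) (hn : Even n) (hn9 : 9 ≤ n)
    (e : Fin n → Fin n → ℝ)
    (hsymm : ∀ i j, e i j = e j i) (hdiag : ∀ i, e i i = 0)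
    (ehat : Fin n → Fin n → ℝ)
    (hehat : ∀ i j, ehat i j = if i = j then 0 else
      e i j - (∑ k, e i k) / ((n : ℝ) - 2) - (∑ k, e k j) / ((n : ℝ) - 2)
        + (∑ k, ∑ l, e k l) / (((n : ℝ) - 1) * ((n : ℝ) - 2)))
    (hnondeg : ∃ i j, i ≠ j ∧ ehat i j ≠ 0)
    (Y : Equiv.Perm (Fin n) → ℝ) (hY : ∀ π, Y π = ∑ i, e i (π i))
    (μE σE2 : ℝ)
    (hμE : μE = (∑ π ∈ fpfInvolutions n, Y π) / (fpfInvolutions n).card)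
    (hσE2 : σE2 = (∑ π ∈ fpfInvolutions n, (Y π - μE) ^ 2) / (fpfInvolutions n).card)
    (βE : ℝ)
    (hβE : βE = (∑ i, ∑ j, if i ≠ j then |ehat i j| ^ 3 else 0) / Real.sqrt σE2 ^ 3)
    (F : ℝ → ℝ)
    (hF : ∀ t, F t = (((fpfInvolutions n).filter
        (fun π => (Y π - μE) / Real.sqrt σE2 ≤ t)).card : ℝ) / (fpfInvolutions n).card)
    (p : ℝ≥0∞) (hp : 1 ≤ p) :
    eLpNorm (fun t => F t - stdNormalCDF t) p volume ≤
      ENNReal.ofReal ((379 : ℝ) ^ (1 / p.toReal) *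
        (61702446 : ℝ) ^ (1 - 1 / p.toReal) * βE / n) := by
  set s : Finset (Fin n) := univ with hs
  have hcard : #s = n := by simp [hs]
  have hse : Even #s := hcard.symm ▸ hn
  have hs10 : 10 ≤ #s := by obtain ⟨m, hm⟩ := hn; omega
  have hn0 : (9 : ℝ) ≤ n := by exact_mod_cast hn9
  rw [fpfInvolutions_eq_matchings] at hμE hσE2
  simp only [fpfInvolutions_eq_matchings] at hF
  have hrec : ehat = recenter e s := by
    funext i j
    rw [hehat, recenter, rowShift, rowShift, hcard]
    split_ifs
    · rfl
    · have h1 : ∑ k, e k j = ∑ k, e j k := sum_congr rfl fun k _ => hsymm k j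
      have h2 : (n : ℝ) - 1 ≠ 0 := by linarith
      have h3 : (n : ℝ) - 2 ≠ 0 := by linarith
      rw [h1]
      field_simp
      ring
  have hcen : IsCentered ehat s := hrec ▸ isCentered_recenter hsymm hdiag (by omega)
  set M := (∑ i ∈ s, ∑ j ∈ s, e i j) / ((#s : ℝ) - 1) with hM
  have hYM : ∀ π ∈ matchings s, Y π = matchSum ehat s π + M := fun π hπ => by
    rw [hY, hrec]; exact matchSum_eq_recenter e (by omega) hπ
  have hμ : μE = M := by
    have h1 : μE = avg s fun π => matchSum ehat s π + M := hμE.trans (avg_congr hYM)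
    rw [h1, avg_add, avg_const hse, avg_matchSum hcen (by omega), zero_add]
  have hYμ : ∀ π ∈ matchings s, Y π - μE = matchSum ehat s π := fun π hπ => by
    rw [hYM π hπ, hμ, add_sub_cancel_right]
  have hσ : avg s (fun π => matchSum ehat s π ^ 2) = σE2 := by
    rw [hσE2]
    exact avg_congr fun π hπ => by rw [hYμ π hπ]
  have hσ0 : 0 < σE2 := by
    obtain ⟨i, j, -, hij⟩ := hnondeg
    rw [← hσ]
    exact avg_matchSum_sq_pos hcen hse (mem_univ i) (mem_univ j) hij
  set a : Fin n → Fin n → ℝ := fun i j => (√σE2)⁻¹ * ehat i j with ha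
  have hac : IsCentered a s := hcen.const_mul _
  have hav : avg s (fun π => matchSum a s π ^ 2) = 1 := avg_normalize_sq hσ0 hσ
  have hβ : sumCube a s = βE := by
    rw [ha, sumCube_const_mul _ _ (by positivity), hβE, div_eq_inv_mul, inv_pow]
    congr 1
    refine sum_congr rfl fun i _ => sum_congr rfl fun j _ => ?_
    split_ifs with h
    · rfl
    · rw [not_not.1 h, hcen.diag]; simp
  have hFa : F = matchCDF a s := by
    funext t
    rw [hF, card_filter, Nat.cast_sum]
    refine avg_congr fun π hπ => ?_
    rw [hYμ π hπ, ha, matchSum_const_mul, div_eq_inv_mul]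
    push_cast
    rfl
  have hδ : 0 ≤ βE / n := div_nonneg (hβ ▸ sumCube_nonneg a s) (by positivity)
  have h1 := integral_abs_matchCDF_sub_le hac hse hs10 hav
  have h2 := abs_matchCDF_sub_stdNormalCDF_le hac hse hs10 hav
  rw [hβ, hcard] at h1
  simp only [hβ, hcard] at h2
  rw [hFa]
  refine (eLpNorm_le_of_integral_abs_le_of_abs_le (integrable_matchCDF_sub a hse) h1 h2 hp).trans_eq
    (congrArg _ ?_)
  have hx : 1 / p.toReal ≤ 1 := by
    rcases eq_or_ne p ⊤ with rfl | hptop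
    · simp
    · have := one_le_toReal hp hptop
      exact (div_le_one (by linarith)).2 this
  have hx0 : 0 ≤ 1 / p.toReal := by positivity
  rw [Real.mul_rpow (by norm_num) hδ, Real.mul_rpow (by norm_num) hδ, mul_mul_mul_comm,
    ← Real.rpow_add_of_nonneg hδ hx0 (by linarith), add_sub_cancel, Real.rpow_one, mul_div_assoc]
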